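/- Let s > 5/2, δ ≥ −3/2, T > 0 and N ≥ 1. Suppose for each t ∈ [0,T] and a = 1, 2, 3 that A^a(t,·) are symmetric N×N matrix-valued functions with A^a(t,·), B(t,·), F(t,·) ∈ H_{s,δ} (componentwise), and that U ∈ C¹([0,T], H_{s,δ}(ℝ³;ℝ^N)) solves the linear symmetric hyperbolic system ∂_t U + Σ_{a=1}^3 A^a ∂_a U + B U = F on [0,T]×ℝ³. Then for t ∈ [0,T], (1/2)(d/dt)⟨U(t), U(t)⟩_{s,δ} ≤ C (‖U(t)‖_{H_{s,δ}}² + ‖F(t,·)‖_{H_{s,δ}}²), where the constant C depends only on s, δ and the H_{s,δ}-norms of the matrices A^a and B. -/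

import Mathlib

open MeasureTheory Real Set
open scoped FourierTransform ENNReal NNReal

noncomputable section

abbrev E3 : Type := EuclideanSpace ℝ (Fin 3)

/-- A dyadic partition of unity on ℝ³ as in the paper: `ψ j ∈ C_0^∞`, nonnegative,
`supp ψ₀ ⊆ {|x| ≤ 2}`, `ψ₀ = 1` on `{|x| ≤ 1}`, for `j ≥ 1`
`supp ψ_j ⊆ {2^(j-2) ≤ |x| ≤ 2^(j+1)}`, `ψ_j = 1` on `{2^(j-1) ≤ |x| ≤ 2^j}`, and
`|∂^α ψ_j| ≤ C_α 2^(-|α| j)` with `C_α` independent of `j`. -/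
structure DyadicPartition where
  ψ : ℕ → E3 → ℝ
  smooth : ∀ j, ContDiff ℝ (⊤ : ℕ∞) (ψ j)
  nonneg : ∀ j x, 0 ≤ ψ j x
  compSupp : ∀ j, HasCompactSupport (ψ j)
  supp_zero : ∀ x : E3, ψ 0 x ≠ 0 → ‖x‖ ≤ 2
  one_zero : ∀ x : E3, ‖x‖ ≤ 1 → ψ 0 x = 1
  supp_succ : ∀ j : ℕ, 1 ≤ j → ∀ x : E3, ψ j x ≠ 0 →
    (2:ℝ) ^ ((j:ℤ) - 2) ≤ ‖x‖ ∧ ‖x‖ ≤ (2:ℝ) ^ ((j:ℤ) + 1)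
  one_succ : ∀ j : ℕ, 1 ≤ j → ∀ x : E3,
    (2:ℝ) ^ ((j:ℤ) - 1) ≤ ‖x‖ → ‖x‖ ≤ (2:ℝ) ^ (j:ℤ) → ψ j x = 1
  deriv_bound : ∀ n : ℕ, ∃ C : ℝ, ∀ (j : ℕ) (x : E3),
    ‖iteratedFDeriv ℝ n (ψ j) x‖ ≤ C * (2:ℝ) ^ (-(n:ℤ) * (j:ℤ))

/-- The squared `H^s` norm `∫ (1+|ξ|²)^s |𝓕f(ξ)|² dξ` of a complex-valued function. -/
def HsNormSq (s : ℝ) (f : E3 → ℂ) : ℝ≥0∞ :=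
  ∫⁻ ξ : E3, ENNReal.ofReal ((1 + ‖ξ‖ ^ 2) ^ s) * (‖𝓕 f ξ‖₊ : ℝ≥0∞) ^ 2

/-- The squared weighted Sobolev norm
`‖u‖²_{H_{s,δ}} = Σ_j 2^{(3/2+δ)2j} ‖(ψ_j u)_{2^j}‖²_{H^s}`,
where `(ψ_j u)_{2^j}(x) = ψ_j(2^j x) u(2^j x)`. -/
def HwNormSq (P : DyadicPartition) (s δ : ℝ) (u : E3 → ℝ) : ℝ≥0∞ :=
  ∑' j : ℕ, ENNReal.ofReal ((2:ℝ) ^ ((3 + 2 * δ) * (j:ℝ))) *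
    HsNormSq s (fun x : E3 =>
      ((P.ψ j (((2:ℝ) ^ (j:ℕ)) • x) * u (((2:ℝ) ^ (j:ℕ)) • x) : ℝ) : ℂ))

/-- Membership in the weighted Sobolev space `H_{s,δ}` (for functions). -/
def MemH (P : DyadicPartition) (s δ : ℝ) (u : E3 → ℝ) : Prop :=
  LocallyIntegrable u volume ∧ HwNormSq P s δ u < ⊤

/-- The weighted Sobolev norm `‖u‖_{H_{s,δ}}`. -/
def Hnorm (P : DyadicPartition) (s δ : ℝ) (u : E3 → ℝ) : ℝ :=
  Real.sqrt (HwNormSq P s δ u).toReal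

/-- The squared weighted `L²_δ` norm `∫ (1+|x|)^{2δ} |u(x)|² dx`. -/
def L2wNormSq (δ : ℝ) (u : E3 → ℝ) : ℝ≥0∞ :=
  ∫⁻ x : E3, ENNReal.ofReal ((1 + ‖x‖) ^ (2 * δ)) * (‖u x‖₊ : ℝ≥0∞) ^ 2

/-- The weighted `L²_δ` norm. -/
def L2wNorm (δ : ℝ) (u : E3 → ℝ) : ℝ :=
  Real.sqrt (L2wNormSq δ u).toReal

/-- Membership in `L²_δ`. -/
def MemL2w (δ : ℝ) (u : E3 → ℝ) : Prop :=
  AEStronglyMeasurable u volume ∧ L2wNormSq δ u < ⊤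

/-- The partial derivative `∂_a f (x)`. -/
def pd (f : E3 → ℝ) (a : Fin 3) (x : E3) : ℝ :=
  fderiv ℝ f x (EuclideanSpace.single a 1)

/-- `t ↦ u(t,·)` is a continuous curve in `H_{s,δ}` on `[0,T]`. -/
def HContOn (P : DyadicPartition) (s δ T : ℝ) (u : ℝ → E3 → ℝ) : Prop :=
  (∀ t ∈ Icc (0:ℝ) T, MemH P s δ (u t)) ∧
  ∀ t ∈ Icc (0:ℝ) T, ∀ ε > (0:ℝ), ∃ η > (0:ℝ), ∀ t' ∈ Icc (0:ℝ) T,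
    |t' - t| < η → Hnorm P s δ (fun x => u t' x - u t x) < ε

/-- `t ↦ u(t,·)` is a `C¹` curve in `H_{s,δ}` on `[0,T]`. -/
def HC1On (P : DyadicPartition) (s δ T : ℝ) (u : ℝ → E3 → ℝ) : Prop :=
  ∃ u' : ℝ → E3 → ℝ, HContOn P s δ T u' ∧
    ∀ t ∈ Icc (0:ℝ) T, ∀ ε > (0:ℝ), ∃ η > (0:ℝ), ∀ t' ∈ Icc (0:ℝ) T, t' ≠ t →
      |t' - t| < η →
      Hnorm P s δ (fun x => (u t' x - u t x) / (t' - t) - u' t x) < ε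

/-- The `H^s` inner product `⟨Λ^s f, Λ^s g⟩_{L²}` expressed on the Fourier side. -/
def innerHs (s : ℝ) (f g : E3 → ℂ) : ℝ :=
  (∫ ξ : E3, (((1 + ‖ξ‖ ^ 2) ^ s : ℝ) : ℂ) * (𝓕 f ξ * starRingEnd ℂ (𝓕 g ξ))).re

/-- The inner product `⟨U,V⟩_{s,δ} = Σ_j 2^{(δ+3/2)2j} ⟨Λ^s[(ψ_j² U)_{2^j}],
Λ^s[(ψ_j² V)_{2^j}]⟩_{L²}` (summed over the components of `U` and `V`). -/
def innerHw {N : ℕ} (P : DyadicPartition) (s δ : ℝ)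
    (U V : E3 → Fin N → ℝ) : ℝ :=
  ∑' j : ℕ, (2:ℝ) ^ ((3 + 2 * δ) * (j:ℝ)) * ∑ i : Fin N,
    innerHs s
      (fun x : E3 =>
        ((P.ψ j (((2:ℝ) ^ (j:ℕ)) • x) ^ 2 * U (((2:ℝ) ^ (j:ℕ)) • x) i : ℝ) : ℂ))
      (fun x : E3 =>
        ((P.ψ j (((2:ℝ) ^ (j:ℕ)) • x) ^ 2 * V (((2:ℝ) ^ (j:ℕ)) • x) i : ℝ) : ℂ))

/-! ### Lebesgue-integral inequalities for convolutions -/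

/-- The `L²` norm of a nonnegative function. -/
def nrmTwo (f : E3 → ℝ≥0∞) : ℝ≥0∞ := (∫⁻ x, f x ^ 2) ^ (1 / 2 : ℝ)

lemma nrmTwo_sq (f : E3 → ℝ≥0∞) : nrmTwo f ^ 2 = ∫⁻ x, f x ^ 2 := by
  rw [nrmTwo, ← ENNReal.rpow_natCast, ← ENNReal.rpow_mul]
  norm_num

lemma nrmTwo_mono {f g : E3 → ℝ≥0∞} (h : ∀ x, f x ≤ g x) : nrmTwo f ≤ nrmTwo g := by
  unfold nrmTwo
  gcongr with x
  exact h x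

lemma nrmTwo_const_mul (c : ℝ≥0∞) (hc : c ≠ ⊤) (f : E3 → ℝ≥0∞) :
    nrmTwo (fun x => c * f x) = c * nrmTwo f := by
  unfold nrmTwo
  simp_rw [mul_pow]
  rw [lintegral_const_mul' _ _ (ENNReal.pow_ne_top hc), ENNReal.mul_rpow_of_nonneg _ _ (by norm_num),
    ← ENNReal.rpow_natCast, ← ENNReal.rpow_mul]
  norm_num

lemma nrmTwo_add_le {f g : E3 → ℝ≥0∞} (hf : AEMeasurable f) (hg : AEMeasurable g) :
    nrmTwo (fun x => f x + g x) ≤ nrmTwo f + nrmTwo g := by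
  have := ENNReal.lintegral_Lp_add_le (p := 2) hf hg (by norm_num)
  simpa [nrmTwo] using this

lemma lintegral_mul_le_nrmTwo {f g : E3 → ℝ≥0∞} (hf : AEMeasurable f) (hg : AEMeasurable g) :
    ∫⁻ x, f x * g x ≤ nrmTwo f * nrmTwo g := by
  have := ENNReal.lintegral_mul_le_Lp_mul_Lq volume Real.HolderConjugate.two_two hf hg
  simpa [nrmTwo] using this

lemma nrmTwo_comp_sub_left (f : E3 → ℝ≥0∞) (a : E3) : nrmTwo (fun x => f (a - x)) = nrmTwo f := by
  unfold nrmTwo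
  rw [lintegral_sub_left_eq_self (fun x => f x ^ 2) a]

lemma nrmTwo_comp_sub_right (f : E3 → ℝ≥0∞) (a : E3) :
    nrmTwo (fun x => f (x - a)) = nrmTwo f := by
  unfold nrmTwo
  rw [lintegral_sub_right_eq_self (fun x => f x ^ 2) a]

/-- The trilinear convolution form `∬ f(ξ) g(ξ-η) h(η)`. -/
def triForm (f g h : E3 → ℝ≥0∞) : ℝ≥0∞ := ∫⁻ ξ, ∫⁻ η, f ξ * g (ξ - η) * h η

lemma triForm_le_one_left {f g h : E3 → ℝ≥0∞} (hf : Measurable f) (hg : Measurable g)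
    (hh : Measurable h) :
    triForm f g h ≤ (∫⁻ x, f x) * nrmTwo g * nrmTwo h := by
  have key : ∀ ξ, ∫⁻ η, f ξ * g (ξ - η) * h η ≤ f ξ * (nrmTwo g * nrmTwo h) := by
    intro ξ
    simp_rw [mul_assoc]
    rw [lintegral_const_mul _ (by fun_prop)]
    gcongr
    refine (lintegral_mul_le_nrmTwo (by fun_prop) hh.aemeasurable).trans ?_
    rw [nrmTwo_comp_sub_left]
  refine (lintegral_mono key).trans ?_
  rw [lintegral_mul_const _ hf, mul_assoc]

lemma triForm_le_one_right {f g h : E3 → ℝ≥0∞} (hf : Measurable f) (hg : Measurable g)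
    (hh : Measurable h) :
    triForm f g h ≤ nrmTwo f * nrmTwo g * ∫⁻ x, h x := by
  unfold triForm
  rw [lintegral_lintegral_swap (by fun_prop)]
  have key : ∀ η, ∫⁻ ξ, f ξ * g (ξ - η) * h η ≤ (nrmTwo f * nrmTwo g) * h η := by
    intro η
    rw [lintegral_mul_const _ (by fun_prop)]
    gcongr
    refine (lintegral_mul_le_nrmTwo hf.aemeasurable (by fun_prop)).trans ?_
    rw [nrmTwo_comp_sub_right]
  refine (lintegral_mono key).trans ?_
  rw [lintegral_const_mul _ hh]

lemma triForm_le_one_mid {f g h : E3 → ℝ≥0∞} (hf : Measurable f) (hg : Measurable g)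
    (hh : Measurable h) :
    triForm f g h ≤ nrmTwo f * (∫⁻ x, g x) * nrmTwo h := by
  have e : triForm f g h = triForm f h g := by
    unfold triForm
    congr 1 with ξ
    rw [← lintegral_sub_left_eq_self _ ξ]
    simp only [sub_sub_cancel]
    congr 1 with η
    ring
  rw [e]
  refine (triForm_le_one_right hf hh hg).trans (le_of_eq ?_)
  ring

/-- Young's inequality `L² * L¹ ⊆ L²`. -/
lemma nrmTwo_conv_le {g h : E3 → ℝ≥0∞} (hg : Measurable g) (hh : Measurable h) :
    nrmTwo (fun ξ => ∫⁻ η, g (ξ - η) * h η) ≤ nrmTwo g * ∫⁻ x, h x := by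
  have hpt : ∀ ξ, (∫⁻ η, g (ξ - η) * h η) ^ 2 ≤
      (∫⁻ η, g (ξ - η) ^ 2 * h η) * ∫⁻ x, h x := by
    intro ξ
    have h1 : ∀ η, h η ^ (1/2 : ℝ) * h η ^ (1/2 : ℝ) = h η := by
      intro η
      rw [← ENNReal.rpow_add_of_nonneg _ _ (by norm_num) (by norm_num)]
      norm_num
    have h2 : ∀ η, (h η ^ (1/2 : ℝ)) ^ 2 = h η := by
      intro η; rw [sq, h1]
    have := lintegral_mul_le_nrmTwo (f := fun η => g (ξ - η) * h η ^ (1/2 : ℝ))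
      (g := fun η => h η ^ (1/2 : ℝ)) (by fun_prop) (by fun_prop)
    simp_rw [mul_assoc, h1] at this
    refine (pow_le_pow_left₀ (zero_le) this 2).trans (le_of_eq ?_)
    rw [mul_pow, nrmTwo_sq, nrmTwo_sq]
    simp_rw [mul_pow, h2]
  have hsq : ∫⁻ ξ, (∫⁻ η, g (ξ - η) * h η) ^ 2 ≤ (∫⁻ x, g x ^ 2) * (∫⁻ x, h x) ^ 2 := by
    refine (lintegral_mono hpt).trans ?_
    rw [lintegral_mul_const]
    · rw [lintegral_lintegral_swap (by fun_prop), sq, ← mul_assoc]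
      gcongr
      rw [← lintegral_const_mul _ hh]
      refine lintegral_mono fun η => ?_
      rw [lintegral_mul_const _ (by fun_prop), lintegral_sub_right_eq_self (fun x => g x ^ 2) η]
    · exact Measurable.lintegral_prod_right (by fun_prop)
  unfold nrmTwo
  refine (ENNReal.rpow_le_rpow hsq (by norm_num)).trans (le_of_eq ?_)
  rw [ENNReal.mul_rpow_of_nonneg _ _ (by norm_num), ← ENNReal.rpow_natCast _ 2, ← ENNReal.rpow_mul]
  norm_num

lemma nrmTwo_conv_le' {g h : E3 → ℝ≥0∞} (hg : Measurable g) (hh : Measurable h) :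
    nrmTwo (fun ξ => ∫⁻ η, g (ξ - η) * h η) ≤ (∫⁻ x, g x) * nrmTwo h := by
  have e : (fun ξ => ∫⁻ η, g (ξ - η) * h η) = fun ξ => ∫⁻ η, h (ξ - η) * g η := by
    funext ξ
    rw [← lintegral_sub_left_eq_self _ ξ]
    simp only [sub_sub_cancel]
    congr 1 with η
    ring
  rw [e, mul_comm]
  exact nrmTwo_conv_le hh hg

/-! ### The Japanese bracket -/

/-- The Japanese bracket `⟨ξ⟩ = (1+|ξ|²)^{1/2}`. -/
def jb (ξ : E3) : ℝ := √(1 + ‖ξ‖ ^ 2)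

lemma jb_sq (ξ : E3) : jb ξ ^ 2 = 1 + ‖ξ‖ ^ 2 := Real.sq_sqrt (by positivity)

lemma one_le_jb (ξ : E3) : 1 ≤ jb ξ := Real.one_le_sqrt.2 (by nlinarith [sq_nonneg ‖ξ‖])

lemma jb_pos (ξ : E3) : 0 < jb ξ := one_pos.trans_le (one_le_jb ξ)

lemma norm_le_jb (ξ : E3) : ‖ξ‖ ≤ jb ξ := Real.le_sqrt_of_sq_le (by linarith)

lemma continuous_jb : Continuous jb := by unfold jb; fun_prop

@[fun_prop]
lemma measurable_jb : Measurable jb := continuous_jb.measurable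

lemma continuous_jb_rpow (s : ℝ) : Continuous fun ξ => jb ξ ^ s :=
  continuous_jb.rpow_const fun ξ => Or.inl (jb_pos ξ).ne'

lemma jb_le_add_norm (ξ η : E3) : jb ξ ≤ jb η + ‖ξ - η‖ := by
  refine (Real.sqrt_le_left (by have := jb_pos η; positivity)).2 ?_
  have h1 := jb_sq η
  have h2 := norm_le_jb η
  have h3 : ‖ξ‖ ≤ ‖η‖ + ‖ξ - η‖ := by
    have := norm_add_le η (ξ - η)
    rwa [add_sub_cancel] at this
  have h4 := norm_nonneg ξ
  have h5 := norm_nonneg (ξ - η)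
  nlinarith

lemma jb_le_jb_add_jb (ξ η : E3) : jb ξ ≤ jb (ξ - η) + jb η := by
  linarith [jb_le_add_norm ξ η, norm_le_jb (ξ - η)]

lemma abs_jb_sub_jb_le (ξ η : E3) : |jb ξ - jb η| ≤ jb (ξ - η) := by
  rw [abs_le]
  constructor
  · have := jb_le_add_norm η ξ
    rw [norm_sub_rev] at this
    linarith [norm_le_jb (ξ - η)]
  · linarith [jb_le_add_norm ξ η, norm_le_jb (ξ - η)]

lemma jb_rpow_sq (s : ℝ) (ξ : E3) : (jb ξ ^ s) ^ 2 = (1 + ‖ξ‖ ^ 2) ^ s := by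
  rw [← jb_sq, ← Real.rpow_natCast, ← Real.rpow_natCast, ← Real.rpow_mul (jb_pos ξ).le,
    ← Real.rpow_mul (jb_pos ξ).le, mul_comm]

lemma rpow_add_le_two_rpow {x y r : ℝ} (hx : 0 ≤ x) (hy : 0 ≤ y) (hr : 0 ≤ r) :
    (x + y) ^ r ≤ 2 ^ r * (x ^ r + y ^ r) := by
  rcases le_total x y with h | h
  · calc (x + y) ^ r ≤ (2 * y) ^ r := by gcongr; linarith
      _ = 2 ^ r * y ^ r := Real.mul_rpow (by norm_num) hy
      _ ≤ _ := by gcongr; have := Real.rpow_nonneg hx r; linarith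
  · calc (x + y) ^ r ≤ (2 * x) ^ r := by gcongr; linarith
      _ = 2 ^ r * x ^ r := Real.mul_rpow (by norm_num) hx
      _ ≤ _ := by gcongr; have := Real.rpow_nonneg hy r; linarith

lemma rpow_sub_rpow_le {x y s : ℝ} (hy : 1 ≤ y) (hxy : y ≤ x) (hs : 1 ≤ s) :
    x ^ s - y ^ s ≤ s * x ^ (s - 1) * (x - y) := by
  have hx : 0 < x := by linarith
  have := one_add_mul_self_le_rpow_one_add (s := y / x - 1) (by
    have : 0 ≤ y / x := by positivity
    linarith) hs
  rw [show 1 + (y / x - 1) = y / x by ring, Real.div_rpow (by linarith) hx.le,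
    le_div_iff₀ (by positivity)] at this
  have e : x ^ s = x ^ (s - 1) * x := by
    rw [← Real.rpow_add_one hx.ne']; ring_nf
  have e2 : (1 + s * (y / x - 1)) * x ^ s = x ^ s - s * x ^ (s-1) * (x - y) := by
    rw [e]; field_simp; ring
  linarith

/-- The basic commutator inequality for the weights `⟨ξ⟩^s`. -/
lemma abs_rpow_sub_rpow_mul_le {x y d s : ℝ} (hx : 1 ≤ x) (hy : 1 ≤ y) (hd : |x - y| ≤ d)
    (hs : 1 ≤ s) :
    |x ^ s - y ^ s| * y ≤ s * 2 ^ (s - 1) * (d ^ s * y + d * y ^ s) := by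
  have hd0 : 0 ≤ d := (abs_nonneg _).trans hd
  have key : ∀ {x y : ℝ}, 1 ≤ y → y ≤ x → |x - y| ≤ d →
      |x ^ s - y ^ s| ≤ s * (d + y) ^ (s - 1) * d := by
    intro x y hy hxy hd
    have h1 : y ^ s ≤ x ^ s := by gcongr
    rw [abs_of_nonneg (by linarith)]
    rw [abs_of_nonneg (by linarith)] at hd
    refine (rpow_sub_rpow_le hy hxy hs).trans ?_
    gcongr
    · linarith
    · linarith
  have hbd : |x ^ s - y ^ s| ≤ s * (d + y) ^ (s - 1) * d := by
    rcases le_total y x with h | h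
    · exact key hy h hd
    · rw [abs_sub_comm]
      refine (key hx h (by rwa [abs_sub_comm])).trans ?_
      gcongr
  have h2 := rpow_add_le_two_rpow hd0 (by linarith : 0 ≤ y) (by linarith : 0 ≤ s - 1)
  have ey : y ^ (s - 1) * y = y ^ s := by
    rw [← Real.rpow_add_one (by positivity)]; ring_nf
  have ed : d ^ (s - 1) * d = d ^ s := by
    rcases eq_or_lt_of_le hd0 with h | h
    · rw [← h, mul_zero, Real.zero_rpow (by linarith)]
    · rw [← Real.rpow_add_one (by positivity)]; ring_nf
  calc |x ^ s - y ^ s| * y ≤ (s * (d + y) ^ (s - 1) * d) * y := by gcongr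
    _ ≤ (s * (2 ^ (s-1) * (d ^ (s-1) + y ^ (s-1))) * d) * y := by gcongr
    _ = s * 2 ^ (s - 1) * (d ^ (s-1) * d * y + d * (y ^ (s-1) * y)) := by ring
    _ = _ := by rw [ey, ed]

lemma jb_rpow_le (s : ℝ) (hs : 0 ≤ s) (ξ η : E3) :
    jb ξ ^ s ≤ 2 ^ s * (jb (ξ - η) ^ s + jb η ^ s) :=
  (Real.rpow_le_rpow (jb_pos ξ).le (jb_le_jb_add_jb ξ η) hs).trans
    (rpow_add_le_two_rpow (jb_pos _).le (jb_pos _).le hs)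

/-! ### Weighted `L²` norms on the Fourier side -/

/-- The weight `⟨ξ⟩^s` as an extended nonnegative real. -/
def jbw (s : ℝ) (ξ : E3) : ℝ≥0∞ := ENNReal.ofReal (jb ξ ^ s)

@[fun_prop]
lemma measurable_jbw (s : ℝ) : Measurable (jbw s) :=
  ENNReal.measurable_ofReal.comp (continuous_jb_rpow s).measurable

lemma jbw_add (s r : ℝ) (ξ : E3) : jbw (s + r) ξ = jbw s ξ * jbw r ξ := by
  rw [jbw, jbw, jbw, ← ENNReal.ofReal_mul (Real.rpow_nonneg (jb_pos ξ).le s),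
    Real.rpow_add (jb_pos ξ)]

lemma jbw_zero (ξ : E3) : jbw 0 ξ = 1 := by simp [jbw]

lemma jbw_mono {s r : ℝ} (h : s ≤ r) (ξ : E3) : jbw s ξ ≤ jbw r ξ :=
  ENNReal.ofReal_le_ofReal (Real.rpow_le_rpow_of_exponent_le (one_le_jb ξ) h)

/-- The weighted norm `‖⟨ξ⟩^s g‖_{L²}`. -/
def wNorm (s : ℝ) (g : E3 → ℂ) : ℝ≥0∞ := nrmTwo fun ξ => jbw s ξ * ‖g ξ‖ₑ

/-- The `H^s` norm. -/
def Hn (s : ℝ) (f : E3 → ℂ) : ℝ≥0∞ := wNorm s (𝓕 f)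

lemma Hn_sq (s : ℝ) (f : E3 → ℂ) : Hn s f ^ 2 = HsNormSq s f := by
  rw [Hn, wNorm, nrmTwo_sq, HsNormSq]
  congr 1 with ξ
  rw [mul_pow, jbw, ← ENNReal.ofReal_pow (Real.rpow_nonneg (jb_pos ξ).le s), jb_rpow_sq]
  rfl

lemma wNorm_mono {s r : ℝ} (h : s ≤ r) (g : E3 → ℂ) : wNorm s g ≤ wNorm r g :=
  nrmTwo_mono fun ξ => mul_le_mul_left (jbw_mono h ξ) _

lemma nrmTwo_jbw_ne_top {r : ℝ} (h : r < -(3 / 2)) : nrmTwo (fun ξ => jbw r ξ) ≠ ⊤ := by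
  have hint : Integrable (fun ξ : E3 => (1 + ‖ξ‖ ^ 2) ^ (-(2 * -r) / 2)) volume :=
    integrable_rpow_neg_one_add_norm_sq (by simp; linarith)
  refine ENNReal.rpow_ne_top_of_nonneg (by norm_num) ?_
  have e : ∀ ξ : E3, jbw r ξ ^ 2 = ENNReal.ofReal ((1 + ‖ξ‖ ^ 2) ^ (-(2 * -r) / 2)) := fun ξ => by
    rw [jbw, ← ENNReal.ofReal_pow (Real.rpow_nonneg (jb_pos ξ).le _), jb_rpow_sq]
    ring_nf
  simp_rw [e]
  exact hint.lintegral_lt_top.ne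

/-- `⟨ξ⟩^r g ∈ L¹` with a bound by `‖⟨ξ⟩^s g‖_{L²}` as soon as `s > r + 3/2`. -/
lemma exists_lintegral_jbw_le (s r : ℝ) (h : r + 3 / 2 < s) :
    ∃ C : ℝ≥0, ∀ g : E3 → ℂ, Measurable g → ∫⁻ ξ, jbw r ξ * ‖g ξ‖ₑ ≤ C * wNorm s g := by
  have hfin : nrmTwo (fun ξ => jbw (r - s) ξ) ≠ ⊤ := nrmTwo_jbw_ne_top (by linarith)
  refine ⟨(nrmTwo (fun ξ => jbw (r - s) ξ)).toNNReal, fun g hg => ?_⟩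
  rw [ENNReal.coe_toNNReal hfin]
  refine le_trans (le_of_eq ?_) (lintegral_mul_le_nrmTwo (f := fun ξ => jbw (r - s) ξ)
    (g := fun ξ => jbw s ξ * ‖g ξ‖ₑ) (by fun_prop) (by fun_prop))
  congr 1 with ξ
  rw [← mul_assoc, ← jbw_add]
  ring_nf

/-! ### Fourier transform of integrable functions -/

lemma continuous_fourier_of_integrable {f : E3 → ℂ} (hf : Integrable f) : Continuous (𝓕 f) :=
  VectorFourier.fourierIntegral_continuous Real.continuous_fourierChar
    (by exact continuous_inner) hf

lemma integral_fourier_mul_eq {f g : E3 → ℂ} (hf : Integrable f) (hg : Integrable g) :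
    ∫ ξ, 𝓕 f ξ * g ξ = ∫ x, f x * 𝓕 g x := by
  simpa using! VectorFourier.integral_fourierIntegral_smul_eq_flip (L := innerₗ E3)
    Real.continuous_fourierChar continuous_inner hf hg

lemma fourier_mul_fourierChar (f : E3 → ℂ) (ξ η : E3) :
    𝓕 (fun x => (𝐞 (-(inner ℝ x ξ)) : ℂ) * f x) η = 𝓕 f (η + ξ) := by
  rw [Real.fourier_eq, Real.fourier_eq]
  congr 1 with x
  simp only [Circle.smul_def, smul_eq_mul, inner_add_right, neg_add, AddChar.map_add_eq_mul,
    Circle.coe_mul]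
  ring

lemma integrable_fourierChar_mul {f : E3 → ℂ} (hf : Integrable f) (ξ : E3) :
    Integrable fun x => (𝐞 (-(inner ℝ x ξ)) : ℂ) * f x := by
  refine hf.bdd_mul (c := 1) (Continuous.aestronglyMeasurable (by fun_prop)) (ae_of_all _ fun x => ?_)
  exact (Circle.norm_coe _).le

/-- The Fourier transform of a product is a convolution of Fourier transforms. -/
lemma fourier_mul_fourierInv {f G : E3 → ℂ} (hf : Integrable f) (hG : Integrable G) (ξ : E3) :
    𝓕 (fun x => f x * 𝓕⁻ G x) ξ = ∫ η, 𝓕 f (ξ - η) * G η := by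
  have h1 : 𝓕 (fun x => f x * 𝓕⁻ G x) ξ =
      ∫ x, ((𝐞 (-(inner ℝ x ξ)) : ℂ) * f x) * 𝓕 (fun y => G (-y)) x := by
    rw [Real.fourier_eq, Real.fourierInv_eq_fourier_comp_neg]
    congr 1 with x
    simp only [Circle.smul_def, smul_eq_mul]
    ring
  rw [h1, ← integral_fourier_mul_eq (integrable_fourierChar_mul hf ξ) hG.comp_neg,
    ← integral_neg_eq_self]
  congr 1 with η
  rw [fourier_mul_fourierChar, neg_neg, neg_add_eq_sub]

lemma integrable_of_lintegral_ne_top {g : E3 → ℂ} (hg : Measurable g)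
    (h : ∫⁻ ξ, ‖g ξ‖ₑ ≠ ⊤) : Integrable g :=
  ⟨hg.aestronglyMeasurable, lt_top_iff_ne_top.2 h⟩

lemma norm_fourierInv_le {G : E3 → ℂ} (x : E3) :
    ‖𝓕⁻ G x‖ₑ ≤ ∫⁻ ξ, ‖G ξ‖ₑ := by
  rw [Real.fourierInv_eq]
  refine (enorm_integral_le_lintegral_enorm _).trans (le_of_eq ?_)
  congr 1 with ξ
  rw [← ofReal_norm, Circle.norm_smul, ofReal_norm]

lemma continuous_fourierInv_of_integrable {G : E3 → ℂ} (hG : Integrable G) :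
    Continuous (𝓕⁻ G) := by
  rw [Real.fourierInv_eq_fourier_comp_neg]
  exact continuous_fourier_of_integrable hG.comp_neg

/-- Fourier inversion almost everywhere. -/
lemma ae_eq_fourierInv_fourier {f : E3 → ℂ} (hf : Integrable f) (hf' : Integrable (𝓕 f)) :
    f =ᵐ[volume] 𝓕⁻ (𝓕 f) := by
  refine ae_eq_of_integral_contDiff_smul_eq hf.locallyIntegrable
    (continuous_fourierInv_of_integrable hf').locallyIntegrable fun g hg hgc => ?_
  let φ : SchwartzMap E3 ℂ := (hgc.comp_left (g := ((↑) : ℝ → ℂ)) rfl).toSchwartzMap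
    (Complex.ofRealCLM.contDiff.comp hg)
  have hφ : ∀ x, φ x = (g x : ℂ) := fun x => rfl
  let θ : SchwartzMap E3 ℂ := 𝓕⁻ φ
  have hθ : 𝓕 θ = φ := by simp [θ]
  have hθ' : 𝓕 (θ : E3 → ℂ) = φ := by rw [← SchwartzMap.fourier_coe, hθ]
  have hθ'' : 𝓕⁻ (φ : E3 → ℂ) = θ := by rw [← SchwartzMap.fourierInv_coe]
  have e1 : ∫ x, g x • f x = ∫ x, f x * 𝓕 (θ : E3 → ℂ) x := by
    rw [hθ']
    congr 1 with x
    rw [hφ, Complex.real_smul, mul_comm]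
  have e2 : ∫ x, g x • 𝓕⁻ (𝓕 f) x = ∫ x, φ x * 𝓕 (fun y => 𝓕 f (-y)) x := by
    rw [Real.fourierInv_eq_fourier_comp_neg]
    congr 1
  rw [e1, e2, ← integral_fourier_mul_eq hf θ.integrable,
    ← integral_fourier_mul_eq φ.integrable hf'.comp_neg, ← integral_neg_eq_self]
  congr 1 with x
  rw [← hθ'', Real.fourierInv_eq_fourier_neg, neg_neg, mul_comm]

/-! ### The spaces `H^s` of integrable functions -/

/-- Integrable functions with finite `H^s` norm. -/
def HsMem (s : ℝ) (f : E3 → ℂ) : Prop := Integrable f ∧ Hn s f < ⊤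

lemma HsMem.measurable {s : ℝ} {f : E3 → ℂ} (hf : HsMem s f) : Measurable (𝓕 f) :=
  (continuous_fourier_of_integrable hf.1).measurable

lemma HsMem.mono {s r : ℝ} {f : E3 → ℂ} (hf : HsMem s f) (h : r ≤ s) : HsMem r f :=
  ⟨hf.1, (wNorm_mono h _).trans_lt hf.2⟩

lemma fourier_fun_add {f g : E3 → ℂ} (hf : Integrable f) (hg : Integrable g) :
    𝓕 (fun x => f x + g x) = fun ξ => 𝓕 f ξ + 𝓕 g ξ := by
  have := VectorFourier.fourierIntegral_add (L := innerₗ E3) (μ := volume)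
    Real.continuous_fourierChar continuous_inner hf hg
  exact this

lemma fourier_fun_const_mul (c : ℂ) (f : E3 → ℂ) :
    𝓕 (fun x => c * f x) = fun ξ => c * 𝓕 f ξ :=
  VectorFourier.fourierIntegral_const_smul 𝐞 volume (innerₗ E3) f c

lemma Hn_add_le {s : ℝ} {f g : E3 → ℂ} (hf : Integrable f) (hg : Integrable g) :
    Hn s (fun x => f x + g x) ≤ Hn s f + Hn s g := by
  have h1 := (continuous_fourier_of_integrable hf).measurable
  have h2 := (continuous_fourier_of_integrable hg).measurable
  rw [Hn, fourier_fun_add hf hg]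
  refine le_trans (nrmTwo_mono fun ξ => ?_) (nrmTwo_add_le (by fun_prop) (by fun_prop))
  rw [← mul_add]
  gcongr
  exact enorm_add_le _ _

lemma Hn_const_mul {s : ℝ} (c : ℂ) (f : E3 → ℂ) :
    Hn s (fun x => c * f x) = ‖c‖ₑ * Hn s f := by
  rw [Hn, fourier_fun_const_mul, wNorm, Hn, wNorm, ← nrmTwo_const_mul _ (by simp)]
  congr 1 with ξ
  rw [enorm_mul]
  ring

lemma HsMem.add {s : ℝ} {f g : E3 → ℂ} (hf : HsMem s f) (hg : HsMem s g) :
    HsMem s (fun x => f x + g x) :=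
  ⟨hf.1.add hg.1, (Hn_add_le hf.1 hg.1).trans_lt (ENNReal.add_lt_top.2 ⟨hf.2, hg.2⟩)⟩

lemma HsMem.const_mul {s : ℝ} {f : E3 → ℂ} (hf : HsMem s f) (c : ℂ) :
    HsMem s (fun x => c * f x) :=
  ⟨hf.1.const_mul c, by rw [Hn_const_mul]; exact ENNReal.mul_lt_top (by simp) hf.2⟩

lemma Hn_sub_le {s : ℝ} {f g : E3 → ℂ} (hf : Integrable f) (hg : Integrable g) :
    Hn s (fun x => f x - g x) ≤ Hn s f + Hn s g := by
  have := Hn_add_le (s := s) hf (hg.const_mul (-1))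
  rw [Hn_const_mul] at this
  simpa [sub_eq_add_neg] using this

lemma HsMem.sub {s : ℝ} {f g : E3 → ℂ} (hf : HsMem s f) (hg : HsMem s g) :
    HsMem s (fun x => f x - g x) :=
  ⟨hf.1.sub hg.1, (Hn_sub_le hf.1 hg.1).trans_lt (ENNReal.add_lt_top.2 ⟨hf.2, hg.2⟩)⟩

lemma HsMem.zero (s : ℝ) : HsMem s (fun _ => 0) := by
  refine ⟨integrable_zero _ _ _, ?_⟩
  have := Hn_const_mul (s := s) 0 (fun _ => (0:ℂ))
  simp only [enorm_zero, zero_mul] at this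
  simp [this]

lemma Hn_zero (s : ℝ) : Hn s (fun _ => 0) = 0 := by
  have := Hn_const_mul (s := s) 0 (fun _ => (0:ℂ))
  simpa using this

lemma HsMem.sum {s : ℝ} {ι : Type*} (S : Finset ι) {f : ι → E3 → ℂ} (h : ∀ i ∈ S, HsMem s (f i)) :
    HsMem s (fun x => ∑ i ∈ S, f i x) ∧ Hn s (fun x => ∑ i ∈ S, f i x) ≤ ∑ i ∈ S, Hn s (f i) := by
  classical
  induction S using Finset.induction_on with
  | empty => simp [Hn_zero, HsMem.zero]
  | insert a S ha ih =>
    obtain ⟨h1, h2⟩ := ih fun i hi => h i (Finset.mem_insert_of_mem hi)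
    have h3 := h a (Finset.mem_insert_self a S)
    simp only [Finset.sum_insert ha]
    exact ⟨h3.add h1, (Hn_add_le h3.1 h1.1).trans (by gcongr)⟩

lemma HsMem.lintegral_jbw_ne_top {s r : ℝ} {f : E3 → ℂ} (hf : HsMem s f) (h : r + 3 / 2 < s) :
    ∫⁻ ξ, jbw r ξ * ‖𝓕 f ξ‖ₑ ≠ ⊤ := by
  obtain ⟨C, hC⟩ := exists_lintegral_jbw_le s r h
  exact ((hC _ hf.measurable).trans_lt (ENNReal.mul_lt_top (by simp) hf.2)).ne

lemma HsMem.integrable_fourier {s : ℝ} {f : E3 → ℂ} (hf : HsMem s f) (h : 3 / 2 < s) :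
    Integrable (𝓕 f) := by
  refine integrable_of_lintegral_ne_top hf.measurable ?_
  have := hf.lintegral_jbw_ne_top (r := 0) (by linarith)
  simpa [jbw_zero] using this

lemma HsMem.ae_eq {s : ℝ} {f : E3 → ℂ} (hf : HsMem s f) (h : 3 / 2 < s) :
    f =ᵐ[volume] 𝓕⁻ (𝓕 f) :=
  ae_eq_fourierInv_fourier hf.1 (hf.integrable_fourier h)

/-- The Sobolev embedding `H^s ⊆ L^∞` for `s > 3/2`. -/
lemma exists_ae_enorm_le (s : ℝ) (h : 3 / 2 < s) :
    ∃ C : ℝ≥0, ∀ f : E3 → ℂ, HsMem s f → ∀ᵐ x, ‖f x‖ₑ ≤ C * Hn s f := by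
  obtain ⟨C, hC⟩ := exists_lintegral_jbw_le s 0 (by linarith)
  refine ⟨C, fun f hf => ?_⟩
  filter_upwards [hf.ae_eq h] with x hx
  rw [hx]
  refine (norm_fourierInv_le x).trans ?_
  simpa [jbw_zero, Hn] using hC _ hf.measurable

lemma HsMem.integrable_mul {s : ℝ} {f g : E3 → ℂ} (hf : HsMem s f) (hg : HsMem s g)
    (h : 3 / 2 < s) : Integrable (fun x => f x * g x) := by
  obtain ⟨C, hC⟩ := exists_ae_enorm_le s h
  have hfin : C * Hn s f ≠ ⊤ := ENNReal.mul_ne_top (by simp) hf.2.ne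
  refine hg.1.bdd_mul (c := (C * Hn s f).toReal) hf.1.aestronglyMeasurable ?_
  filter_upwards [hC f hf] with x hx
  rw [← toReal_enorm]
  exact ENNReal.toReal_mono hfin hx

lemma HsMem.fourier_mul {s : ℝ} {f g : E3 → ℂ} (hf : HsMem s f) (hg : HsMem s g)
    (h : 3 / 2 < s) (ξ : E3) :
    𝓕 (fun x => f x * g x) ξ = ∫ η, 𝓕 f (ξ - η) * 𝓕 g η := by
  rw [← fourier_mul_fourierInv hf.1 (hg.integrable_fourier h)]
  refine Real.fourier_congr_ae ?_ ξ
  filter_upwards [hg.ae_eq h] with x hx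
  rw [← hx]

/-- `H^s` is an algebra for `s > 3/2`. -/
lemma exists_Hn_mul_le (s : ℝ) (h : 3 / 2 < s) :
    ∃ C : ℝ≥0, ∀ f g : E3 → ℂ, HsMem s f → HsMem s g →
      HsMem s (fun x => f x * g x) ∧ Hn s (fun x => f x * g x) ≤ C * Hn s f * Hn s g := by
  obtain ⟨C, hC⟩ := exists_lintegral_jbw_le s 0 (by linarith)
  simp only [jbw_zero, one_mul] at hC
  let K : ℝ≥0 := (2 ^ s : ℝ).toNNReal
  have hK : ∀ ξ η, jbw s ξ ≤ K * (jbw s (ξ - η) + jbw s η) := by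
    intro ξ η
    have h0 : ∀ ξ, 0 ≤ jb ξ ^ s := fun ξ => Real.rpow_nonneg (jb_pos ξ).le s
    rw [jbw, jbw, jbw, ← ENNReal.ofReal_add (h0 _) (h0 _), ← ENNReal.ofReal,
      ← ENNReal.ofReal_mul (by positivity)]
    exact ENNReal.ofReal_le_ofReal (jb_rpow_le s (by linarith) ξ η)
  have main : ∀ f g : E3 → ℂ, HsMem s f → HsMem s g →
      Hn s (fun x => f x * g x) ≤ ((K * (C + C) : ℝ≥0) : ℝ≥0∞) * Hn s f * Hn s g := by
    intro f g hf hg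
    have mf := hf.measurable
    have mg := hg.measurable
    have hpt : ∀ ξ, jbw s ξ * ‖𝓕 (fun x => f x * g x) ξ‖ₑ ≤
        K * ((∫⁻ η, (jbw s (ξ - η) * ‖𝓕 f (ξ - η)‖ₑ) * ‖𝓕 g η‖ₑ) +
          ∫⁻ η, ‖𝓕 f (ξ - η)‖ₑ * (jbw s η * ‖𝓕 g η‖ₑ)) := by
      intro ξ
      rw [hf.fourier_mul hg h, ← lintegral_add_left (by fun_prop),
        ← lintegral_const_mul _ (by fun_prop)]
      refine (mul_le_mul_right (enorm_integral_le_lintegral_enorm _) _).trans ?_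
      rw [← lintegral_const_mul _ (by fun_prop)]
      refine lintegral_mono fun η => ?_
      rw [enorm_mul]
      refine (mul_le_mul_left (hK ξ η) _).trans (le_of_eq ?_)
      ring
    rw [Hn, wNorm]
    refine (nrmTwo_mono hpt).trans ?_
    rw [nrmTwo_const_mul _ (by simp)]
    have h1 := nrmTwo_conv_le (g := fun ξ => jbw s ξ * ‖𝓕 f ξ‖ₑ) (h := fun ξ => ‖𝓕 g ξ‖ₑ)
      (by fun_prop) (by fun_prop)
    have h2 := nrmTwo_conv_le' (g := fun ξ => ‖𝓕 f ξ‖ₑ) (h := fun ξ => jbw s ξ * ‖𝓕 g ξ‖ₑ)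
      (by fun_prop) (by fun_prop)
    have h3 : nrmTwo (fun ξ => (∫⁻ η, (jbw s (ξ - η) * ‖𝓕 f (ξ - η)‖ₑ) * ‖𝓕 g η‖ₑ) +
          ∫⁻ η, ‖𝓕 f (ξ - η)‖ₑ * (jbw s η * ‖𝓕 g η‖ₑ)) ≤
        Hn s f * (C * Hn s g) + (C * Hn s f) * Hn s g := by
      refine (nrmTwo_add_le ?_ ?_).trans ?_
      · exact (Measurable.lintegral_prod_right (by fun_prop)).aemeasurable
      · exact (Measurable.lintegral_prod_right (by fun_prop)).aemeasurable
      · refine add_le_add (h1.trans ?_) (h2.trans ?_)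
        · exact mul_le_mul_right (hC _ mg) _
        · exact mul_le_mul_left (hC _ mf) _
    refine (mul_le_mul_right h3 _).trans (le_of_eq ?_)
    push_cast
    ring
  exact ⟨K * (C + C), fun f g hf hg => ⟨⟨hf.integrable_mul hg h, (main f g hf hg).trans_lt
    (ENNReal.mul_lt_top (ENNReal.mul_lt_top ENNReal.coe_lt_top hf.2) hg.2)⟩, main f g hf hg⟩⟩

/-! ### Skew-symmetry of first order operators up to bounded terms -/

/-- The frequency cutoff `(1 + ε|ξ|²)⁻¹`. -/
def freqCut (ε : ℝ) (ξ : E3) : ℝ := (1 + ε * ‖ξ‖ ^ 2)⁻¹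

lemma freqCut_pos {ε : ℝ} (hε : 0 < ε) (ξ : E3) : 0 < freqCut ε ξ := by
  unfold freqCut; positivity

lemma freqCut_le_one {ε : ℝ} (hε : 0 < ε) (ξ : E3) : freqCut ε ξ ≤ 1 :=
  inv_le_one_of_one_le₀ (by nlinarith [sq_nonneg ‖ξ‖, mul_nonneg hε.le (sq_nonneg ‖ξ‖)])

@[fun_prop]
lemma measurable_freqCut (ε : ℝ) : Measurable (freqCut ε) := by
  unfold freqCut; fun_prop

lemma freqCut_mul_jb_sq_le {ε : ℝ} (hε : 0 < ε) (ξ : E3) :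
    freqCut ε ξ * jb ξ ^ 2 ≤ 1 + ε⁻¹ := by
  rw [jb_sq, freqCut, inv_mul_le_iff₀ (by positivity)]
  have : ε * ε⁻¹ = 1 := mul_inv_cancel₀ hε.ne'
  have h2 : 0 ≤ ‖ξ‖ ^ 2 := by positivity
  have h3 : 0 < ε⁻¹ := by positivity
  nlinarith [mul_nonneg hε.le h2]

lemma abs_freqCut_mul_sub_le {ε : ℝ} (hε : 0 < ε) (ξ η : E3) {p q : ℝ} (hp : |p| ≤ ‖ξ‖)
    (hpq : |q - p| ≤ ‖ξ - η‖) :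
    |freqCut ε ξ * q - freqCut ε η * p| ≤ 3 * ‖ξ - η‖ := by
  set m := freqCut ε ξ
  set n := freqCut ε η
  have hm := freqCut_pos hε ξ
  have hn := freqCut_pos hε η
  have hm1 := freqCut_le_one hε ξ
  have hn1 := freqCut_le_one hε η
  have em : m * (1 + ε * ‖ξ‖ ^ 2) = 1 := inv_mul_cancel₀ (by positivity)
  have en : n * (1 + ε * ‖η‖ ^ 2) = 1 := inv_mul_cancel₀ (by positivity)
  have e : m - n = ε * (‖η‖ ^ 2 - ‖ξ‖ ^ 2) * m * n := by
    linear_combination n * em - m * en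
  have hd : |‖η‖ - ‖ξ‖| ≤ ‖ξ - η‖ := by
    rw [abs_sub_comm]; exact abs_norm_sub_norm_le ξ η
  have h1 : |m - n| * |p| ≤ 2 * ‖ξ - η‖ := by
    have h2 : |m - n| = ε * (‖η‖ + ‖ξ‖) * |‖η‖ - ‖ξ‖| * m * n := by
      rw [e, show ε * (‖η‖ ^ 2 - ‖ξ‖ ^ 2) * m * n =
        ε * (‖η‖ + ‖ξ‖) * m * n * (‖η‖ - ‖ξ‖) by ring, abs_mul, abs_of_nonneg (by positivity)]
      ring
    have h3 : ε * (‖η‖ + ‖ξ‖) * m * n * ‖ξ‖ ≤ 2 := by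
      have a1 : m * (ε * ‖ξ‖ ^ 2) ≤ 1 := by nlinarith
      have a2 : n * (ε * ‖η‖ ^ 2) ≤ 1 := by nlinarith
      have a3 : 0 ≤ m * (ε * ‖ξ‖ ^ 2) := by positivity
      have a4 : 0 ≤ n * (ε * ‖η‖ ^ 2) := by positivity
      have b1 : m * (ε * ‖ξ‖ ^ 2) * n ≤ 1 := by nlinarith
      have b2 : n * (ε * ‖η‖ ^ 2) * m ≤ 1 := by nlinarith
      have b3 : ε * m * n * (‖η‖ * ‖ξ‖) ≤ ε * m * n * ((‖ξ‖ ^ 2 + ‖η‖ ^ 2) / 2) := by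
        gcongr
        nlinarith [sq_nonneg (‖ξ‖ - ‖η‖)]
      nlinarith
    calc |m - n| * |p| ≤ |m - n| * ‖ξ‖ := by gcongr
      _ = (ε * (‖η‖ + ‖ξ‖) * m * n * ‖ξ‖) * |‖η‖ - ‖ξ‖| := by rw [h2]; ring
      _ ≤ 2 * ‖ξ - η‖ := by gcongr
  calc |m * q - n * p| = |m * (q - p) + (m - n) * p| := by congr 1; ring
    _ ≤ |m * (q - p)| + |(m - n) * p| := abs_add_le _ _
    _ = m * |q - p| + |m - n| * |p| := by rw [abs_mul, abs_mul, abs_of_pos hm]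
    _ ≤ 1 * ‖ξ - η‖ + 2 * ‖ξ - η‖ := by gcongr
    _ = _ := by ring

/-- The weight controlling the symmetrized kernel. -/
def triWeight (s : ℝ) (ξ η : E3) : ℝ :=
  jb ξ ^ s * jb (ξ - η) ^ s * jb η + jb ξ * jb (ξ - η) ^ s * jb η ^ s +
    jb ξ ^ s * jb (ξ - η) * jb η ^ s

lemma abs_symm_kernel_le {s ε : ℝ} (hs : 1 ≤ s) (hε : 0 < ε) (ξ η : E3) {p q : ℝ}
    (hp : |p| ≤ ‖ξ‖) (hq : |q| ≤ ‖η‖) (hpq : |q - p| ≤ ‖ξ - η‖) :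
    |freqCut ε ξ * (1 + ‖ξ‖ ^ 2) ^ s * q - freqCut ε η * (1 + ‖η‖ ^ 2) ^ s * p| ≤
      (2 * (s * 2 ^ (s - 1)) + 3) * triWeight s ξ η := by
  have hm := freqCut_pos hε ξ
  have hn := freqCut_pos hε η
  have hm1 := freqCut_le_one hε ξ
  have hn1 := freqCut_le_one hε η
  have hd := abs_jb_sub_jb_le ξ η
  have hd' : |jb η - jb ξ| ≤ jb (ξ - η) := by rwa [abs_sub_comm]
  have k1 := abs_rpow_sub_rpow_mul_le (one_le_jb ξ) (one_le_jb η) hd hs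
  have k2 := abs_rpow_sub_rpow_mul_le (one_le_jb η) (one_le_jb ξ) hd' hs
  have k3 := (abs_freqCut_mul_sub_le hε ξ η hp hpq).trans
    (mul_le_mul_of_nonneg_left (norm_le_jb (ξ - η)) (by norm_num))
  have hp' := hp.trans (norm_le_jb ξ)
  have hq' := hq.trans (norm_le_jb η)
  rw [← jb_rpow_sq, ← jb_rpow_sq]
  rw [abs_sub_comm] at k2
  set X := jb ξ ^ s with hX
  set Y := jb η ^ s with hY
  set Z := jb (ξ - η) ^ s with hZ
  have X0 : 0 ≤ X := Real.rpow_nonneg (jb_pos _).le _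
  have Y0 : 0 ≤ Y := Real.rpow_nonneg (jb_pos _).le _
  have Z0 : 0 ≤ Z := Real.rpow_nonneg (jb_pos _).le _
  have x0 := jb_pos ξ
  have y0 := jb_pos η
  have z0 := jb_pos (ξ - η)
  set m := freqCut ε ξ
  set n := freqCut ε η
  set c := s * 2 ^ (s - 1) with hc
  have c0 : 0 ≤ c := by positivity
  have e : m * X ^ 2 * q - n * Y ^ 2 * p =
      m * X * ((X - Y) * q) + n * Y * ((X - Y) * p) + X * Y * (m * q - n * p) := by ring
  rw [e]
  have t1 : |m * X * ((X - Y) * q)| ≤ X * (c * (Z * jb η + jb (ξ - η) * Y)) := by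
    rw [abs_mul, abs_mul (X - Y), abs_of_nonneg (by positivity)]
    calc m * X * (|X - Y| * |q|) ≤ 1 * X * (|X - Y| * jb η) := by gcongr
      _ ≤ 1 * X * (c * (Z * jb η + jb (ξ - η) * Y)) := by gcongr
      _ = _ := by ring
  have t2 : |n * Y * ((X - Y) * p)| ≤ Y * (c * (Z * jb ξ + jb (ξ - η) * X)) := by
    rw [abs_mul, abs_mul (X - Y), abs_of_nonneg (by positivity)]
    calc n * Y * (|X - Y| * |p|) ≤ 1 * Y * (|X - Y| * jb ξ) := by gcongr
      _ ≤ 1 * Y * (c * (Z * jb ξ + jb (ξ - η) * X)) := by gcongr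
      _ = _ := by ring
  have t3 : |X * Y * (m * q - n * p)| ≤ X * Y * (3 * jb (ξ - η)) := by
    rw [abs_mul, abs_of_nonneg (by positivity : 0 ≤ X * Y)]
    gcongr
  refine (abs_add_le _ _).trans ((add_le_add ((abs_add_le _ _).trans (add_le_add t1 t2)) t3).trans ?_)
  unfold triWeight
  rw [← hX, ← hY, ← hZ]
  have w1 : 0 ≤ X * Z * jb η := by positivity
  have w2 : 0 ≤ jb ξ * Z * Y := by positivity
  nlinarith [mul_nonneg c0 w1, mul_nonneg c0 w2]

lemma abs_kernel_le {s ε : ℝ} (hs : 1 ≤ s) (hε : 0 < ε) (ξ η : E3) {q : ℝ} (hq : |q| ≤ ‖η‖) :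
    |freqCut ε ξ * (1 + ‖ξ‖ ^ 2) ^ s * q| ≤ ((1 + ε⁻¹) * 2 ^ (s - 1)) * triWeight s ξ η := by
  have hm := freqCut_pos hε ξ
  have h1 := freqCut_mul_jb_sq_le hε ξ
  have hq' := hq.trans (norm_le_jb η)
  have x0 := jb_pos ξ
  have y0 := jb_pos η
  have z0 := jb_pos (ξ - η)
  have x1 := one_le_jb ξ
  have z1 := one_le_jb (ξ - η)
  have y1 := one_le_jb η
  have h2 := jb_rpow_le (s - 1) (by linarith) ξ η
  have er : ∀ ζ : E3, jb ζ ^ s = jb ζ ^ (s - 1) * jb ζ := fun ζ => by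
    rw [← Real.rpow_add_one (jb_pos ζ).ne']; ring_nf
  rw [← jb_rpow_sq, abs_mul, abs_of_nonneg (by positivity)]
  have X0 : 0 ≤ jb ξ ^ (s - 1) := Real.rpow_nonneg (jb_pos _).le _
  have Y0 : 0 ≤ jb η ^ (s - 1) := Real.rpow_nonneg (jb_pos _).le _
  have Z0 : 0 ≤ jb (ξ - η) ^ (s - 1) := Real.rpow_nonneg (jb_pos _).le _
  have k1 : freqCut ε ξ * (jb ξ ^ s) ^ 2 * |q| ≤
      (1 + ε⁻¹) * (jb ξ ^ (s - 1) * jb ξ ^ (s - 1) * jb η) := by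
    calc freqCut ε ξ * (jb ξ ^ s) ^ 2 * |q| ≤ freqCut ε ξ * (jb ξ ^ s) ^ 2 * jb η := by gcongr
      _ = (freqCut ε ξ * jb ξ ^ 2) * (jb ξ ^ (s - 1) * jb ξ ^ (s - 1) * jb η) := by
        rw [er]; ring
      _ ≤ _ := by gcongr
  have k2 : jb ξ ^ (s - 1) * jb ξ ^ (s - 1) * jb η ≤ 2 ^ (s - 1) * triWeight s ξ η := by
    calc jb ξ ^ (s - 1) * jb ξ ^ (s - 1) * jb η
        ≤ (jb ξ ^ (s - 1) * jb ξ) *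
          (2 ^ (s - 1) * (jb (ξ - η) ^ (s - 1) + jb η ^ (s - 1))) * jb η := by
          gcongr
          exact le_mul_of_one_le_right X0 x1
      _ = 2 ^ (s - 1) * (jb ξ ^ s * (jb (ξ - η) ^ (s - 1) * 1) * jb η +
            jb ξ ^ s * 1 * jb η ^ s) := by
          rw [er ξ, er η]; ring
      _ ≤ 2 ^ (s - 1) * (jb ξ ^ s * (jb (ξ - η) ^ (s - 1) * jb (ξ - η)) * jb η +
            jb ξ ^ s * jb (ξ - η) * jb η ^ s) := by gcongr
      _ ≤ 2 ^ (s - 1) * triWeight s ξ η := by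
          rw [← er]
          unfold triWeight
          gcongr
          have : 0 ≤ jb ξ * jb (ξ - η) ^ s * jb η ^ s := by positivity
          linarith
  calc _ ≤ _ := k1
    _ ≤ (1 + ε⁻¹) * (2 ^ (s - 1) * triWeight s ξ η) := by gcongr
    _ = _ := by ring

@[fun_prop]
lemma measurable_triWeight (s : ℝ) : Measurable fun z : E3 × E3 => triWeight s z.1 z.2 := by
  have h := (continuous_jb_rpow s).measurable
  have h2 := measurable_jb
  unfold triWeight
  have a1 : Measurable fun z : E3 × E3 => jb z.1 ^ s := h.comp measurable_fst
  have a2 : Measurable fun z : E3 × E3 => jb z.2 ^ s := h.comp measurable_snd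
  have a3 : Measurable fun z : E3 × E3 => jb (z.1 - z.2) ^ s :=
    h.comp (measurable_fst.sub measurable_snd)
  fun_prop

lemma exists_lintegral_triWeight_le (s : ℝ) (hs : 5 / 2 < s) :
    ∃ C : ℝ≥0, ∀ α p q : E3 → ℂ, Measurable α → Measurable p → Measurable q →
      ∫⁻ z : E3 × E3, ENNReal.ofReal (triWeight s z.1 z.2) *
        (‖p z.1‖ₑ * ‖α (z.1 - z.2)‖ₑ * ‖q z.2‖ₑ) ≤ C * (wNorm s α * wNorm s p * wNorm s q) := by
  obtain ⟨C, hC⟩ := exists_lintegral_jbw_le s 1 (by linarith)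
  refine ⟨3 * C, fun α p q hα hp hq => ?_⟩
  rw [Measure.volume_eq_prod, lintegral_prod _ (by fun_prop)]
  have hw : ∀ ξ η, ENNReal.ofReal (triWeight s ξ η) = jbw s ξ * jbw s (ξ - η) * jbw 1 η +
      jbw 1 ξ * jbw s (ξ - η) * jbw s η + jbw s ξ * jbw 1 (ξ - η) * jbw s η := by
    intro ξ η
    have h0 : ∀ r ξ, 0 ≤ jb ξ ^ (r : ℝ) := fun r ξ => Real.rpow_nonneg (jb_pos ξ).le r
    have h1 := h0 s ξ
    have h2 := h0 s η
    have h3 := h0 s (ξ - η)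
    have := jb_pos ξ
    have := jb_pos η
    have := jb_pos (ξ - η)
    simp only [jbw, Real.rpow_one]
    unfold triWeight
    rw [ENNReal.ofReal_add (by positivity) (by positivity),
      ENNReal.ofReal_add (by positivity) (by positivity), ENNReal.ofReal_mul (by positivity),
      ENNReal.ofReal_mul (by positivity), ENNReal.ofReal_mul (by positivity),
      ENNReal.ofReal_mul (by positivity), ENNReal.ofReal_mul (by positivity),
      ENNReal.ofReal_mul (by positivity)]
  have e : ∀ ξ, ∫⁻ η, ENNReal.ofReal (triWeight s ξ η) * (‖p ξ‖ₑ * ‖α (ξ - η)‖ₑ * ‖q η‖ₑ) =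
      (∫⁻ η, (jbw s ξ * ‖p ξ‖ₑ) * (jbw s (ξ - η) * ‖α (ξ - η)‖ₑ) * (jbw 1 η * ‖q η‖ₑ)) +
      (∫⁻ η, (jbw 1 ξ * ‖p ξ‖ₑ) * (jbw s (ξ - η) * ‖α (ξ - η)‖ₑ) * (jbw s η * ‖q η‖ₑ)) +
      ∫⁻ η, (jbw s ξ * ‖p ξ‖ₑ) * (jbw 1 (ξ - η) * ‖α (ξ - η)‖ₑ) * (jbw s η * ‖q η‖ₑ) := by
    intro ξ
    rw [← lintegral_add_left (by fun_prop), ← lintegral_add_left (by fun_prop)]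
    congr 1 with η
    rw [hw]; ring
  simp_rw [e]
  rw [lintegral_add_left (by fun_prop), lintegral_add_left (by fun_prop)]
  have b1 := triForm_le_one_right (f := fun ξ => jbw s ξ * ‖p ξ‖ₑ)
    (g := fun ξ => jbw s ξ * ‖α ξ‖ₑ) (h := fun ξ => jbw 1 ξ * ‖q ξ‖ₑ)
    (by fun_prop) (by fun_prop) (by fun_prop)
  have b2 := triForm_le_one_left (f := fun ξ => jbw 1 ξ * ‖p ξ‖ₑ)
    (g := fun ξ => jbw s ξ * ‖α ξ‖ₑ) (h := fun ξ => jbw s ξ * ‖q ξ‖ₑ)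
    (by fun_prop) (by fun_prop) (by fun_prop)
  have b3 := triForm_le_one_mid (f := fun ξ => jbw s ξ * ‖p ξ‖ₑ)
    (g := fun ξ => jbw 1 ξ * ‖α ξ‖ₑ) (h := fun ξ => jbw s ξ * ‖q ξ‖ₑ)
    (by fun_prop) (by fun_prop) (by fun_prop)
  refine (add_le_add (add_le_add
    (b1.trans (mul_le_mul_right (hC q hq) _))
    (b2.trans (mul_le_mul_left (mul_le_mul_left (hC p hp) _) _)))
    (b3.trans (mul_le_mul_left (mul_le_mul_right (hC α hα) _) _))).trans (le_of_eq ?_)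
  simp only [wNorm]
  push_cast
  ring

/-- The kernel of the regularized first order form. -/
def advKer (s ε : ℝ) (a : Fin 3) (α p q : E3 → ℂ) (z : E3 × E3) : ℂ :=
  ((freqCut ε z.1 * (1 + ‖z.1‖ ^ 2) ^ s * z.2 a : ℝ) : ℂ) * (2 * π * Complex.I) *
    (starRingEnd ℂ (p z.1) * α (z.1 - z.2) * q z.2)

lemma abs_coord_le (ξ : E3) (a : Fin 3) : |ξ a| ≤ ‖ξ‖ := by
  simpa using PiLp.norm_apply_le ξ a

lemma measurable_advKer {s ε : ℝ} {a : Fin 3} {α p q : E3 → ℂ} (hα : Measurable α)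
    (hp : Measurable p) (hq : Measurable q) : Measurable (advKer s ε a α p q) := by
  have h1 : Measurable fun ξ : E3 => (1 + ‖ξ‖ ^ 2) ^ s := by fun_prop
  have h2 : Measurable fun z : E3 × E3 => (1 + ‖z.1‖ ^ 2) ^ s := h1.comp measurable_fst
  have h3 : Measurable fun z : E3 × E3 => z.2 a := by fun_prop
  have h4 : Measurable fun z : E3 × E3 => starRingEnd ℂ (p z.1) :=
    Complex.continuous_conj.measurable.comp (hp.comp measurable_fst)
  unfold advKer
  fun_prop

lemma enorm_two_pi_I : ‖(2 * π * Complex.I : ℂ)‖ₑ = ENNReal.ofReal (2 * π) := by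
  rw [← ofReal_norm]
  simp [abs_of_pos Real.pi_pos]

lemma enorm_complex_ofReal (r : ℝ) : ‖(r : ℂ)‖ₑ = ENNReal.ofReal |r| := by
  rw [← ofReal_norm, Complex.norm_real, Real.norm_eq_abs]

lemma integrable_advKer {s ε : ℝ} (hs : 5 / 2 < s) (hε : 0 < ε) (a : Fin 3) {α p q : E3 → ℂ}
    (hα : Measurable α) (hp : Measurable p) (hq : Measurable q) (hα' : wNorm s α < ⊤)
    (hp' : wNorm s p < ⊤) (hq' : wNorm s q < ⊤) : Integrable (advKer s ε a α p q) := by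
  obtain ⟨C, hC⟩ := exists_lintegral_triWeight_le s hs
  refine ⟨(measurable_advKer hα hp hq).aestronglyMeasurable, ?_⟩
  have hK : 0 ≤ (1 + ε⁻¹) * 2 ^ (s - 1) := by positivity
  have hpt : ∀ z : E3 × E3, ‖advKer s ε a α p q z‖ₑ ≤
      ENNReal.ofReal ((1 + ε⁻¹) * 2 ^ (s - 1)) * ENNReal.ofReal (2 * π) *
      (ENNReal.ofReal (triWeight s z.1 z.2) * (‖p z.1‖ₑ * ‖α (z.1 - z.2)‖ₑ * ‖q z.2‖ₑ)) := by
    intro z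
    have := abs_kernel_le (by linarith : 1 ≤ s) hε z.1 z.2 (abs_coord_le z.2 a)
    rw [advKer, enorm_mul, enorm_mul, enorm_two_pi_I, enorm_mul, enorm_mul,
      RCLike.enorm_conj, enorm_complex_ofReal]
    refine (mul_le_mul_left (mul_le_mul_left (ENNReal.ofReal_le_ofReal this) _) _).trans
      (le_of_eq ?_)
    rw [ENNReal.ofReal_mul hK]
    ring
  refine (lintegral_mono hpt).trans_lt ?_
  rw [lintegral_const_mul' _ _ (by finiteness)]
  refine ENNReal.mul_lt_top (by finiteness) ((hC α p q hα hp hq).trans_lt ?_)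
  exact ENNReal.mul_lt_top (by simp) (ENNReal.mul_lt_top (ENNReal.mul_lt_top hα' hp') hq')

/-- The regularized first order form is skew-symmetric up to a bounded form. -/
lemma exists_advKer_symm_le (s : ℝ) (hs : 5 / 2 < s) :
    ∃ C : ℝ≥0, ∀ ε : ℝ, 0 < ε → ∀ (a : Fin 3) (α p q : E3 → ℂ),
      Measurable α → Measurable p → Measurable q → wNorm s α < ⊤ → wNorm s p < ⊤ →
      wNorm s q < ⊤ → (∀ ζ, starRingEnd ℂ (α (-ζ)) = α ζ) →
      ENNReal.ofReal |(∫ z, advKer s ε a α p q z).re + (∫ z, advKer s ε a α q p z).re| ≤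
        C * (wNorm s α * wNorm s p * wNorm s q) := by
  obtain ⟨C, hC⟩ := exists_lintegral_triWeight_le s hs
  set K := 2 * (s * 2 ^ (s - 1)) + 3 with hK
  have hK0 : 0 ≤ K := by
    have : 0 < s := by linarith
    positivity
  refine ⟨K.toNNReal * (2 * π).toNNReal * C,
    fun ε hε a α p q hα hp hq hα' hp' hq' hconj => ?_⟩
  have i1 := integrable_advKer hs hε a hα hp hq hα' hp' hq'
  have i2 := integrable_advKer hs hε a hα hq hp hα' hq' hp'
  have i3 : Integrable fun z : E3 × E3 => starRingEnd ℂ (advKer s ε a α q p z.swap) :=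
    (Complex.conjCLE.toContinuousLinearMap).integrable_comp i2.swap
  have e1 : (∫ z, advKer s ε a α q p z).re =
      (∫ z : E3 × E3, starRingEnd ℂ (advKer s ε a α q p z.swap)).re := by
    rw [integral_conj, Complex.conj_re]
    congr 1
    exact (integral_prod_swap _).symm
  rw [e1, ← Complex.add_re, ← integral_add i1 i3]
  have hpt : ∀ z : E3 × E3, ‖advKer s ε a α p q z + starRingEnd ℂ (advKer s ε a α q p z.swap)‖ₑ ≤
      ENNReal.ofReal K * ENNReal.ofReal (2 * π) *
      (ENNReal.ofReal (triWeight s z.1 z.2) * (‖p z.1‖ₑ * ‖α (z.1 - z.2)‖ₑ * ‖q z.2‖ₑ)) := by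
    rintro ⟨ξ, η⟩
    have e : advKer s ε a α p q (ξ, η) + starRingEnd ℂ (advKer s ε a α q p (η, ξ)) =
        ((freqCut ε ξ * (1 + ‖ξ‖ ^ 2) ^ s * η a - freqCut ε η * (1 + ‖η‖ ^ 2) ^ s * ξ a : ℝ) : ℂ) *
          (2 * π * Complex.I) * (starRingEnd ℂ (p ξ) * α (ξ - η) * q η) := by
      have : starRingEnd ℂ (α (η - ξ)) = α (ξ - η) := by
        have := hconj (ξ - η)
        rwa [neg_sub] at this
      simp only [advKer, map_mul, Complex.conj_ofReal, Complex.conj_I, Complex.conj_conj, this,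
        map_ofNat]
      push_cast
      ring
    have hb := abs_symm_kernel_le (by linarith : 1 ≤ s) hε ξ η (abs_coord_le ξ a)
      (abs_coord_le η a) (by
        have := abs_coord_le (ξ - η) a
        rwa [PiLp.sub_apply, abs_sub_comm] at this)
    simp only [Prod.swap_prod_mk]
    rw [e, enorm_mul, enorm_mul, enorm_two_pi_I, enorm_mul, enorm_mul,
      RCLike.enorm_conj, enorm_complex_ofReal]
    refine (mul_le_mul_left (mul_le_mul_left (ENNReal.ofReal_le_ofReal hb) _) _).trans
      (le_of_eq ?_)
    rw [ENNReal.ofReal_mul hK0]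
    ring
  calc _ ≤ ENNReal.ofReal ‖∫ z : E3 × E3, advKer s ε a α p q z +
          starRingEnd ℂ (advKer s ε a α q p z.swap)‖ :=
        ENNReal.ofReal_le_ofReal (Complex.abs_re_le_norm _)
    _ ≤ _ := by
      rw [ofReal_norm]
      refine (enorm_integral_le_lintegral_enorm _).trans ((lintegral_mono hpt).trans ?_)
      rw [lintegral_const_mul' _ _ (by finiteness)]
      refine (mul_le_mul_right (hC α p q hα hp hq) _).trans (le_of_eq ?_)
      simp only [ENNReal.ofReal]
      push_cast
      ring

lemma enorm_weight_mul (s : ℝ) (u v : E3 → ℂ) (ξ : E3) :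
    ‖(((1 + ‖ξ‖ ^ 2) ^ s : ℝ) : ℂ) * (u ξ * starRingEnd ℂ (v ξ))‖ₑ =
      jbw s ξ * ‖u ξ‖ₑ * (jbw s ξ * ‖v ξ‖ₑ) := by
  have h0 : 0 ≤ jb ξ ^ s := Real.rpow_nonneg (jb_pos ξ).le s
  rw [enorm_mul, enorm_mul, RCLike.enorm_conj, enorm_complex_ofReal, ← jb_rpow_sq,
    abs_of_nonneg (by positivity), sq, ENNReal.ofReal_mul h0, ← jbw]
  ring

lemma lintegral_enorm_weight_mul_le {s : ℝ} {f g : E3 → ℂ} (hf : HsMem s f) (hg : HsMem s g) :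
    ∫⁻ ξ, ‖(((1 + ‖ξ‖ ^ 2) ^ s : ℝ) : ℂ) * (𝓕 f ξ * starRingEnd ℂ (𝓕 g ξ))‖ₑ ≤
      Hn s f * Hn s g := by
  have h1 := hf.measurable
  have h2 := hg.measurable
  have h3 := measurable_jbw s
  simp only [enorm_weight_mul]
  exact lintegral_mul_le_nrmTwo (by fun_prop) (by fun_prop)

lemma integrable_weight_mul {s : ℝ} {f g : E3 → ℂ} (hf : HsMem s f) (hg : HsMem s g) :
    Integrable fun ξ : E3 =>
      (((1 + ‖ξ‖ ^ 2) ^ s : ℝ) : ℂ) * (𝓕 f ξ * starRingEnd ℂ (𝓕 g ξ)) := by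
  have h1 := hf.measurable
  have h2 : Measurable fun ξ => starRingEnd ℂ (𝓕 g ξ) :=
    Complex.continuous_conj.measurable.comp hg.measurable
  refine ⟨Measurable.aestronglyMeasurable (by fun_prop), ?_⟩
  exact (lintegral_enorm_weight_mul_le hf hg).trans_lt (ENNReal.mul_lt_top hf.2 hg.2)

/-- The Cauchy--Schwarz inequality for the `H^s` inner product. -/
lemma ofReal_abs_innerHs_le {s : ℝ} {f g : E3 → ℂ} (hf : HsMem s f) (hg : HsMem s g) :
    ENNReal.ofReal |innerHs s f g| ≤ Hn s f * Hn s g := by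
  refine (ENNReal.ofReal_le_ofReal (Complex.abs_re_le_norm _)).trans ?_
  rw [ofReal_norm]
  exact (enorm_integral_le_lintegral_enorm _).trans (lintegral_enorm_weight_mul_le hf hg)

lemma abs_innerHs_le {s : ℝ} {f g : E3 → ℂ} (hf : HsMem s f) (hg : HsMem s g) :
    |innerHs s f g| ≤ (Hn s f).toReal * (Hn s g).toReal := by
  rw [← ENNReal.toReal_mul, ← ENNReal.ofReal_le_iff_le_toReal (ENNReal.mul_lt_top hf.2 hg.2).ne]
  exact ofReal_abs_innerHs_le hf hg

lemma innerHs_symm (s : ℝ) (f g : E3 → ℂ) : innerHs s f g = innerHs s g f := by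
  rw [innerHs, ← Complex.conj_re, ← integral_conj, innerHs]
  congr 2 with ξ
  simp [mul_comm]

lemma innerHs_add_right {s : ℝ} {f g h : E3 → ℂ} (hf : HsMem s f) (hg : HsMem s g)
    (hh : HsMem s h) :
    innerHs s f (fun x => g x + h x) = innerHs s f g + innerHs s f h := by
  rw [innerHs, fourier_fun_add hg.1 hh.1, innerHs, innerHs, ← Complex.add_re,
    ← integral_add (integrable_weight_mul hf hg) (integrable_weight_mul hf hh)]
  congr 2 with ξ
  simp only [map_add]
  ring

lemma innerHs_const_mul_right {s : ℝ} (f g : E3 → ℂ) (c : ℝ) :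
    innerHs s f (fun x => c * g x) = c * innerHs s f g := by
  rw [innerHs, fourier_fun_const_mul, innerHs, ← Complex.re_ofReal_mul, ← integral_const_mul]
  congr 2 with ξ
  simp only [map_mul, Complex.conj_ofReal]
  ring

lemma innerHs_sub_right {s : ℝ} {f g h : E3 → ℂ} (hf : HsMem s f) (hg : HsMem s g)
    (hh : HsMem s h) :
    innerHs s f (fun x => g x - h x) = innerHs s f g - innerHs s f h := by
  have h1 := innerHs_add_right hf hg (hh.const_mul ((-1 : ℝ) : ℂ))
  rw [innerHs_const_mul_right] at h1
  simpa [sub_eq_add_neg] using h1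

lemma conj_fourier_neg (f : E3 → ℝ) (ζ : E3) :
    starRingEnd ℂ (𝓕 (fun x => (f x : ℂ)) (-ζ)) = 𝓕 (fun x => (f x : ℂ)) ζ := by
  rw [Real.fourier_eq, Real.fourier_eq, ← integral_conj]
  congr 1 with x
  simp only [Circle.smul_def, smul_eq_mul, map_mul, Complex.conj_ofReal, inner_neg_right, neg_neg]
  congr 1
  rw [AddChar.map_neg_eq_inv, Circle.coe_inv_eq_conj]

/-- The symbol of `∂_a` applied to the Fourier transform. -/
def derivHat (a : Fin 3) (p : E3 → ℂ) (η : E3) : ℂ := 2 * π * Complex.I * (η a : ℂ) * p η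

lemma enorm_derivHat_le (a : Fin 3) (p : E3 → ℂ) (η : E3) :
    ‖derivHat a p η‖ₑ ≤ ENNReal.ofReal (2 * π) * (jbw 1 η * ‖p η‖ₑ) := by
  rw [derivHat, enorm_mul, enorm_mul, enorm_two_pi_I, enorm_complex_ofReal, mul_assoc]
  gcongr
  rw [jbw, rpow_one]
  exact ENNReal.ofReal_le_ofReal ((abs_coord_le η a).trans (norm_le_jb η))

lemma measurable_derivHat (a : Fin 3) {p : E3 → ℂ} (hp : Measurable p) :
    Measurable (derivHat a p) := by
  unfold derivHat
  fun_prop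

lemma HsMem.integrable_derivHat {s : ℝ} {f : E3 → ℂ} (hf : HsMem s f) (hs : 5 / 2 < s)
    (a : Fin 3) : Integrable (derivHat a (𝓕 f)) := by
  refine integrable_of_lintegral_ne_top (measurable_derivHat a hf.measurable) ?_
  refine ((lintegral_mono (enorm_derivHat_le a _)).trans_lt ?_).ne
  rw [lintegral_const_mul' _ _ (by finiteness)]
  exact ENNReal.mul_lt_top (by finiteness)
    (lt_top_iff_ne_top.2 (hf.lintegral_jbw_ne_top (by linarith)))

lemma HsMem.pd_eq {s : ℝ} {v : E3 → ℝ} (hv : HsMem s fun x => (v x : ℂ)) (hs : 5 / 2 < s)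
    (hd : Differentiable ℝ v) (a : Fin 3) (x : E3) :
    (pd v a x : ℂ) = 𝓕⁻ (derivHat a (𝓕 fun x => (v x : ℂ))) x := by
  set V := 𝓕 fun x => (v x : ℂ) with hV
  have hVi : Integrable V := hv.integrable_fourier (by linarith)
  have hVi' : Integrable fun ξ : E3 => ‖ξ‖ * ‖V ξ‖ := by
    refine ⟨(continuous_norm.aestronglyMeasurable.mul hVi.1.norm), ?_⟩
    refine (lintegral_mono fun ξ => ?_).trans_lt
      (lt_top_iff_ne_top.2 (hv.lintegral_jbw_ne_top (r := 1) (by linarith)))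
    rw [enorm_mul, enorm_norm, enorm_norm, ← ofReal_norm, jbw, rpow_one]
    gcongr
    exact norm_le_jb ξ
  have hinv : (fun x => (v x : ℂ)) = 𝓕 fun ξ => V (-ξ) := by
    rw [← Real.fourierInv_eq_fourier_comp_neg]
    exact ((Complex.continuous_ofReal.comp hd.continuous).fourierInv_fourier_eq hv.1 hVi).symm
  have hi2 : Integrable fun ξ : E3 => ‖ξ‖ * ‖V (-ξ)‖ := by
    simpa using hVi'.comp_neg
  have h1 := Real.hasFDerivAt_fourier hVi.comp_neg hi2 x
  rw [← hinv] at h1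
  have h2 : HasFDerivAt (fun x => (v x : ℂ)) (Complex.ofRealCLM.comp (fderiv ℝ v x)) x :=
    Complex.ofRealCLM.hasFDerivAt.comp x (hd x).hasFDerivAt
  have h3 := congrArg (fun L => L (EuclideanSpace.single a (1 : ℝ))) (h2.unique h1)
  have hi3 : Integrable (VectorFourier.fourierSMulRight (innerSL ℝ) fun ξ : E3 => V (-ξ)) := by
    refine (hi2.const_mul (2 * π)).mono' hVi.comp_neg.1.fourierSMulRight (ae_of_all _ fun ξ => ?_)
    refine (VectorFourier.norm_fourierSMulRight_le _ _ _).trans ?_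
    have := norm_innerSL_le (𝕜 := ℝ) (E := E3)
    calc _ ≤ 2 * π * 1 * ‖ξ‖ * ‖V (-ξ)‖ := by gcongr
      _ = 2 * π * (‖ξ‖ * ‖V (-ξ)‖) := by ring
  simp only [ContinuousLinearMap.comp_apply] at h3
  rw [Real.fourier_continuousLinearMap_apply hi3] at h3
  rw [pd, Real.fourierInv_eq_fourier_comp_neg]
  refine h3.trans (congrArg (fun F : E3 → ℂ => 𝓕 F x) ?_)
  ext ξ
  have : innerSL ℝ ξ (EuclideanSpace.single a (1 : ℝ)) = ξ a := by
    rw [innerSL_apply_apply]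
    exact (EuclideanSpace.inner_single_right a (1 : ℝ) ξ).trans (by simp)
  simp [derivHat, this]
  ring

/-- The Fourier transform of `b ∂_a v`. -/
lemma HsMem.fourier_mul_pd {s : ℝ} {v : E3 → ℝ} (hv : HsMem s fun x => (v x : ℂ))
    (hs : 5 / 2 < s) (hd : Differentiable ℝ v) (a : Fin 3) {b : E3 → ℂ} (hb : Integrable b) :
    Integrable (fun x => b x * (pd v a x : ℂ)) ∧
    ∀ ξ, 𝓕 (fun x => b x * (pd v a x : ℂ)) ξ =
      ∫ η, 𝓕 b (ξ - η) * derivHat a (𝓕 fun x => (v x : ℂ)) η := by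
  have hi := hv.integrable_derivHat hs a
  simp only [hv.pd_eq hs hd a]
  refine ⟨?_, fun ξ => fourier_mul_fourierInv hb hi ξ⟩
  refine hb.mul_bdd (c := (∫⁻ ξ, ‖derivHat a (𝓕 fun x => (v x : ℂ)) ξ‖ₑ).toReal)
    (continuous_fourierInv_of_integrable hi).aestronglyMeasurable (ae_of_all _ fun x => ?_)
  rw [← toReal_enorm]
  exact ENNReal.toReal_mono hi.2.ne (norm_fourierInv_le x)

lemma integral_advKer_eq {s ε : ℝ} (hs : 5 / 2 < s) (hε : 0 < ε) (a : Fin 3) {b p : E3 → ℂ}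
    {v : E3 → ℝ} (hb : HsMem s b) (hp : HsMem s p) (hv : HsMem s fun x => (v x : ℂ))
    (hd : Differentiable ℝ v) :
    Integrable (fun ξ => (freqCut ε ξ : ℂ) * ((((1 + ‖ξ‖ ^ 2) ^ s : ℝ) : ℂ) *
      (𝓕 (fun x => b x * (pd v a x : ℂ)) ξ * starRingEnd ℂ (𝓕 p ξ)))) ∧
    ∫ z, advKer s ε a (𝓕 b) (𝓕 p) (𝓕 fun x => (v x : ℂ)) z =
      ∫ ξ, (freqCut ε ξ : ℂ) * ((((1 + ‖ξ‖ ^ 2) ^ s : ℝ) : ℂ) *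
        (𝓕 (fun x => b x * (pd v a x : ℂ)) ξ * starRingEnd ℂ (𝓕 p ξ))) := by
  have hi := integrable_advKer hs hε a hb.measurable hp.measurable hv.measurable hb.2 hp.2 hv.2
  have h1 : ∀ ξ, ∫ η, advKer s ε a (𝓕 b) (𝓕 p) (𝓕 fun x => (v x : ℂ)) (ξ, η) =
      (freqCut ε ξ : ℂ) * ((((1 + ‖ξ‖ ^ 2) ^ s : ℝ) : ℂ) *
        (𝓕 (fun x => b x * (pd v a x : ℂ)) ξ * starRingEnd ℂ (𝓕 p ξ))) := by
    intro ξ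
    rw [(hv.fourier_mul_pd hs hd a hb.1).2, ← integral_mul_const, ← integral_const_mul,
      ← integral_const_mul]
    congr 1 with η
    simp only [advKer, derivHat]
    push_cast
    ring
  constructor
  · simp only [← h1]
    exact Integrable.integral_prod_left hi
  · simp only [← h1]
    exact integral_prod _ hi

lemma tendsto_freqCut_integral {h : E3 → ℂ} (hh : Integrable h) :
    Filter.Tendsto (fun n : ℕ => ∫ ξ, (freqCut (1 / ((n : ℝ) + 1)) ξ : ℂ) * h ξ) Filter.atTop
      (nhds (∫ ξ, h ξ)) := by
  refine tendsto_integral_of_dominated_convergence (fun ξ => ‖h ξ‖) (fun n => ?_) hh.norm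
    (fun n => ae_of_all _ fun ξ => ?_) (ae_of_all _ fun ξ => ?_)
  · exact (Complex.measurable_ofReal.comp (measurable_freqCut _)).aestronglyMeasurable.mul hh.1
  · have hε : 0 < 1 / ((n : ℝ) + 1) := by positivity
    rw [norm_mul, Complex.norm_real, Real.norm_eq_abs, abs_of_pos (freqCut_pos hε ξ)]
    exact mul_le_of_le_one_left (norm_nonneg _) (freqCut_le_one hε ξ)
  · have h1 : Filter.Tendsto (fun n : ℕ => freqCut (1 / ((n : ℝ) + 1)) ξ) Filter.atTop
        (nhds (1 + 0 * ‖ξ‖ ^ 2)⁻¹) := by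
      refine Filter.Tendsto.inv₀ ?_ (by simp)
      exact (tendsto_one_div_add_atTop_nhds_zero_nat.mul_const _).const_add _
    simpa using ((Complex.continuous_ofReal.tendsto _).comp h1).mul_const (h ξ)

/-- The principal part of a symmetric hyperbolic operator is skew-symmetric in `H^s` up to a
bounded form. -/
lemma exists_sum_innerHs_le (s : ℝ) (hs : 5 / 2 < s) :
    ∃ C : ℝ≥0, ∀ (N : ℕ) (b : Fin 3 → Fin N → Fin N → E3 → ℝ) (v g : Fin N → E3 → ℝ),
      (∀ a i k, b a i k = b a k i) → (∀ a i k, HsMem s fun x => (b a i k x : ℂ)) →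
      (∀ i, HsMem s fun x => (v i x : ℂ)) → (∀ i, Differentiable ℝ (v i)) →
      (∀ i, HsMem s fun x => (g i x : ℂ)) →
      (∀ i, ∀ᵐ x, g i x = ∑ a, ∑ k, b a i k x * pd (v k) a x) →
      ENNReal.ofReal |∑ i, innerHs s (fun x => (v i x : ℂ)) fun x => (g i x : ℂ)| ≤
        C * ∑ i, ∑ a, ∑ k, Hn s (fun x => (b a i k x : ℂ)) * Hn s (fun x => (v i x : ℂ)) *
          Hn s (fun x => (v k x : ℂ)) := by
  obtain ⟨C, hC⟩ := exists_advKer_symm_le s hs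
  refine ⟨C, fun N b v g hsymm hb hv hd hg hgeq => ?_⟩
  set S : ℝ → ℝ := fun ε => ∑ i, (∫ ξ, (freqCut ε ξ : ℂ) * ((((1 + ‖ξ‖ ^ 2) ^ s : ℝ) : ℂ) *
        (𝓕 (fun x => (g i x : ℂ)) ξ * starRingEnd ℂ (𝓕 (fun x => (v i x : ℂ)) ξ)))).re with hS
  have hlim : Filter.Tendsto (fun n : ℕ => S (1 / ((n : ℝ) + 1))) Filter.atTop
      (nhds (∑ i, innerHs s (fun x => (v i x : ℂ)) fun x => (g i x : ℂ))) := by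
    refine tendsto_finsetSum _ fun i _ => ?_
    rw [innerHs_symm]
    exact (Complex.continuous_re.tendsto _).comp
      (tendsto_freqCut_integral (integrable_weight_mul (hg i) (hv i)))
  have hbound : ∀ ε > 0, ENNReal.ofReal |S ε| ≤
      C * ∑ i, ∑ a, ∑ k, Hn s (fun x => (b a i k x : ℂ)) * Hn s (fun x => (v i x : ℂ)) *
          Hn s (fun x => (v k x : ℂ)) := by
    intro ε hε
    set J : Fin 3 → Fin N → Fin N → ℝ := fun a i k =>
      (∫ z, advKer s ε a (𝓕 fun x => (b a i k x : ℂ)) (𝓕 fun x => (v i x : ℂ))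
        (𝓕 fun x => (v k x : ℂ)) z).re with hJ
    have hSJ : S ε = ∑ i, ∑ a, ∑ k, J a i k := by
      refine Finset.sum_congr rfl fun i _ => ?_
      have hg' : 𝓕 (fun x => (g i x : ℂ)) = fun ξ =>
          ∑ a, ∑ k, 𝓕 (fun x => (b a i k x : ℂ) * (pd (v k) a x : ℂ)) ξ := by
        have e : (fun x => (g i x : ℂ)) =ᵐ[volume]
            fun x => ∑ a, ∑ k, (b a i k x : ℂ) * (pd (v k) a x : ℂ) := by
          filter_upwards [hgeq i] with x hx
          rw [hx]
          push_cast
          rfl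
        ext ξ
        rw [Real.fourier_congr_ae e ξ]
        have hii : ∀ a k, Integrable fun x => (b a i k x : ℂ) * (pd (v k) a x : ℂ) :=
          fun a k => ((hv k).fourier_mul_pd hs (hd k) a (hb a i k).1).1
        simp only [Real.fourier_eq, Finset.smul_sum]
        rw [integral_finsetSum]
        · refine Finset.sum_congr rfl fun a _ => ?_
          rw [integral_finsetSum]
          exact fun k _ => (Real.fourierIntegral_convergent_iff ξ).2 (hii a k)
        · exact fun a _ => integrable_finsetSum _ fun k _ =>
            (Real.fourierIntegral_convergent_iff ξ).2 (hii a k)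
      have key := fun a k => integral_advKer_eq hs hε a (hb a i k) (hv i) (hv k) (hd k)
      simp only [hg', Finset.sum_mul, Finset.mul_sum]
      rw [integral_finsetSum _ fun a _ => integrable_finsetSum _ fun k _ => (key a k).1,
        Complex.re_sum]
      refine Finset.sum_congr rfl fun a _ => ?_
      rw [integral_finsetSum _ fun k _ => (key a k).1, Complex.re_sum]
      refine Finset.sum_congr rfl fun k _ => ?_
      exact (congrArg Complex.re (key a k).2).symm
    have hswap : S ε = ∑ i, ∑ a, ∑ k, J a k i := by
      rw [hSJ, Finset.sum_comm]
      conv_rhs => rw [Finset.sum_comm]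
      exact Finset.sum_congr rfl fun a _ => Finset.sum_comm
    have h2 : 2 * S ε = ∑ i, ∑ a, ∑ k, (J a i k + J a k i) := by
      rw [two_mul]
      nth_rewrite 1 [hSJ]
      rw [hswap]
      simp only [Finset.sum_add_distrib]
    have h3 : |S ε| ≤ ∑ i, ∑ a, ∑ k, |J a i k + J a k i| := by
      calc |S ε| ≤ |2 * S ε| := by rw [abs_mul, abs_two]; linarith [abs_nonneg (S ε)]
        _ ≤ _ := by
          rw [h2]
          refine (Finset.abs_sum_le_sum_abs _ _).trans (Finset.sum_le_sum fun i _ => ?_)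
          refine (Finset.abs_sum_le_sum_abs _ _).trans (Finset.sum_le_sum fun a _ => ?_)
          exact Finset.abs_sum_le_sum_abs _ _
    refine (ENNReal.ofReal_le_ofReal h3).trans ?_
    simp only [Finset.mul_sum]
    rw [ENNReal.ofReal_sum_of_nonneg fun _ _ => by positivity]
    refine Finset.sum_le_sum fun i _ => ?_
    rw [ENNReal.ofReal_sum_of_nonneg fun _ _ => by positivity]
    refine Finset.sum_le_sum fun a _ => ?_
    rw [ENNReal.ofReal_sum_of_nonneg fun _ _ => by positivity]
    refine Finset.sum_le_sum fun k _ => ?_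
    have := hC ε hε a _ _ _ (hb a i k).measurable (hv i).measurable (hv k).measurable
      (hb a i k).2 (hv i).2 (hv k).2 (conj_fourier_neg (b a i k))
    simp only [hJ, hsymm a k i]
    exact this
  refine le_of_tendsto (((ENNReal.continuous_ofReal.comp continuous_abs).tendsto _).comp hlim)
    (Filter.Eventually.of_forall fun n => ?_)
  exact hbound _ (by positivity)

lemma nrmTwo_comp_smul {g : E3 → ℝ≥0∞} (hg : Measurable g) {r : ℝ} (hr : r ≠ 0) :
    nrmTwo (fun x => g (r • x)) = (ENNReal.ofReal |(r ^ 3)⁻¹|) ^ (1 / 2 : ℝ) * nrmTwo g := by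
  have h := lintegral_map (μ := volume) (f := fun x => g x ^ 2) (by fun_prop)
    (measurable_const_smul (α := E3) r)
  rw [Measure.map_addHaar_smul volume hr, lintegral_smul_measure] at h
  rw [nrmTwo, ← h, nrmTwo, ← ENNReal.mul_rpow_of_nonneg _ _ (by norm_num)]
  simp

lemma jb_smul_le {r : ℝ} (hr : 0 ≤ r) (η : E3) : jb (r • η) ≤ (1 + r) * jb η := by
  refine Real.sqrt_le_iff.2 ⟨mul_nonneg (by linarith) (jb_pos η).le, ?_⟩
  rw [mul_pow, jb_sq, norm_smul, Real.norm_eq_abs, abs_of_nonneg hr]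
  nlinarith [mul_nonneg hr (sq_nonneg ‖η‖), sq_nonneg ‖η‖, sq_nonneg r]

lemma fourier_comp_smul (f : E3 → ℂ) {r : ℝ} (hr : r ≠ 0) :
    𝓕 (fun x => f (r • x)) = fun ξ => ((|(r ^ 3)⁻¹| : ℝ) : ℂ) * 𝓕 f (r⁻¹ • ξ) := by
  ext ξ
  have h := Measure.integral_comp_smul (volume : Measure E3)
    (fun x => 𝐞 (-(inner ℝ x (r⁻¹ • ξ))) • f x) r
  rw [Real.fourier_eq, Real.fourier_eq, ← Complex.real_smul]
  simp only [finrank_euclideanSpace, Fintype.card_fin] at h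
  rw [← h]
  congr 1 with x
  rw [inner_smul_left, inner_smul_right]
  simp [hr]

/-- `H^s` is invariant under dilations. -/
lemma exists_Hn_comp_smul_le (s r : ℝ) (hs : 0 ≤ s) (hr : 0 < r) :
    ∃ C : ℝ≥0, ∀ f : E3 → ℂ, HsMem s f →
      HsMem s (fun x => f (r • x)) ∧ Hn s (fun x => f (r • x)) ≤ C * Hn s f := by
  set c₁ : ℝ≥0 := ((1 + r) ^ s).toNNReal * (|(r ^ 3)⁻¹|).toNNReal
  set c₂ : ℝ≥0∞ := (ENNReal.ofReal |(r⁻¹ ^ 3)⁻¹|) ^ (1 / 2 : ℝ)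
  have hc₂ : c₂ ≠ ⊤ := ENNReal.rpow_ne_top_of_nonneg (by norm_num) (by simp)
  have key : ∀ f : E3 → ℂ, HsMem s f →
      Hn s (fun x => f (r • x)) ≤ (c₁ * c₂.toNNReal : ℝ≥0) * Hn s f := by
    intro f hf
    have hm := hf.measurable
    have hj := measurable_jbw s
    rw [Hn, fourier_comp_smul f hr.ne', wNorm]
    calc _ ≤ nrmTwo fun ξ => (c₁ : ℝ≥0∞) *
          (fun η => jbw s η * ‖𝓕 f η‖ₑ) (r⁻¹ • ξ) := by
          refine nrmTwo_mono fun ξ => ?_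
          have h1 : jbw s ξ ≤ ENNReal.ofReal ((1 + r) ^ s) * jbw s (r⁻¹ • ξ) := by
            rw [jbw, jbw, ← ENNReal.ofReal_mul (by positivity),
              ← Real.mul_rpow (by linarith) (jb_pos _).le]
            refine ENNReal.ofReal_le_ofReal (Real.rpow_le_rpow (jb_pos _).le ?_ hs)
            have := jb_smul_le hr.le (r⁻¹ • ξ)
            rwa [smul_inv_smul₀ hr.ne'] at this
          refine (mul_le_mul_left h1 _).trans (le_of_eq ?_)
          rw [enorm_mul, enorm_complex_ofReal, abs_abs]
          simp only [c₁, ENNReal.ofReal]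
          push_cast
          ring
      _ = _ := by
          rw [nrmTwo_const_mul _ (by simp),
            nrmTwo_comp_smul (g := fun η => jbw s η * ‖𝓕 f η‖ₑ) (by fun_prop) (inv_ne_zero hr.ne')]
          push_cast
          rw [ENNReal.coe_toNNReal hc₂, mul_assoc]
          rfl
  exact ⟨c₁ * c₂.toNNReal, fun f hf => ⟨⟨hf.1.comp_smul hr.ne', (key f hf).trans_lt
    (ENNReal.mul_lt_top ENNReal.coe_lt_top hf.2)⟩, key f hf⟩⟩

/-- Smooth functions supported in a fixed ball are bounded in `H^σ` by finitely many sup norms of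
their derivatives. -/
lemma exists_Hn_le_of_iteratedFDeriv (σ R : ℝ) :
    ∃ (m : ℕ) (C : ℝ≥0), ∀ (φ : E3 → ℂ) (B : ℝ), ContDiff ℝ (⊤ : ℕ∞) φ →
      (∀ x, φ x ≠ 0 → ‖x‖ ≤ R) → (∀ n ≤ m, ∀ x, ‖iteratedFDeriv ℝ n φ x‖ ≤ B) →
      HsMem σ φ ∧ Hn σ φ ≤ C * ENNReal.ofReal B := by
  obtain ⟨m, hm⟩ := exists_nat_gt (σ + 3 / 2)
  have hfin := nrmTwo_jbw_ne_top (r := σ - m) (by linarith)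
  set V : ℝ := (volume (Metric.closedBall (0 : E3) R)).toReal with hV
  set K : ℝ := 2 ^ m * (V + 2 ^ m * ((m + 1) * V)) with hK
  have hV0 : 0 ≤ V := ENNReal.toReal_nonneg
  have hK0 : 0 ≤ K := by positivity
  refine ⟨m, K.toNNReal * (nrmTwo fun ξ => jbw (σ - m) ξ).toNNReal, fun φ B hφ hsupp hB => ?_⟩
  have hB0 : 0 ≤ B := (norm_nonneg _).trans (hB 0 (Nat.zero_le _) 0)
  have hzero : ∀ n : ℕ, ∀ x ∉ Metric.closedBall (0 : E3) R, iteratedFDeriv ℝ n φ x = 0 := by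
    intro n x hx
    have : tsupport φ ⊆ Metric.closedBall 0 R :=
      closure_minimal (fun y hy => by simpa using hsupp y hy) Metric.isClosed_closedBall
    by_contra hne
    exact hx (this (support_iteratedFDeriv_subset (𝕜 := ℝ) n hne))
  have hcomp : HasCompactSupport φ := HasCompactSupport.intro (isCompact_closedBall (0 : E3) R)
    fun x hx => by
      by_contra hne
      exact hx (by simpa using hsupp x hne)
  have hint : ∀ n : ℕ, Integrable fun x => ‖iteratedFDeriv ℝ n φ x‖ := fun n =>
    ((hφ.continuous_iteratedFDeriv (by exact_mod_cast le_top)).integrable_of_hasCompactSupport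
      (hcomp.iteratedFDeriv n)).norm
  have hbd : ∀ n ≤ m, ∫ x, ‖iteratedFDeriv ℝ n φ x‖ ≤ B * V := by
    intro n hn
    rw [← setIntegral_eq_integral_of_forall_compl_eq_zero
      (s := Metric.closedBall (0 : E3) R) fun x hx => by simp [hzero n x hx]]
    refine (Real.le_norm_self _).trans
      (norm_setIntegral_le_of_norm_le_const measure_closedBall_lt_top fun x _ => ?_)
    simpa using hB n hn x
  have hφi : Integrable φ := hφ.continuous.integrable_of_hasCompactSupport hcomp
  have hpow : ∀ n ≤ m, ∀ ξ, ‖ξ‖ ^ n * ‖𝓕 φ ξ‖ ≤ 2 ^ n * ((n + 1) * (B * V)) := by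
    intro n hn ξ
    have h := Real.pow_mul_norm_iteratedFDeriv_fourier_le (K := 0) (N := ⊤) hφ
      (fun k n' hk _ => by
        have : k = 0 := by simpa using hk
        subst this
        simpa using hint n') (k := 0) (n := n) le_rfl le_top ξ
    simp only [norm_iteratedFDeriv_zero, pow_zero, one_mul, Nat.cast_zero, mul_zero, zero_add,
      Finset.range_one, Finset.singleton_product, Finset.sum_map, Function.Embedding.coeFn_mk] at h
    refine h.trans ?_
    gcongr
    refine (Finset.sum_le_card_nsmul _ _ (B * V) fun i hi => hbd i ?_).trans ?_
    · have := Finset.mem_range.1 hi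
      omega
    · simp
  have hjb : ∀ ξ, jb ξ ^ (m : ℝ) * ‖𝓕 φ ξ‖ ≤ K * B := by
    intro ξ
    have h0 := hpow 0 (Nat.zero_le _) ξ
    have h1 := hpow m le_rfl ξ
    have h2 : jb ξ ≤ 1 + ‖ξ‖ := by simpa [jb] using jb_le_add_norm ξ 0
    have h3 : jb ξ ^ m ≤ 2 ^ m * (1 + ‖ξ‖ ^ m) := by
      refine (pow_le_pow_left₀ (jb_pos ξ).le h2 m).trans ?_
      have h4 := add_pow_le (zero_le_one) (norm_nonneg ξ) m
      rw [one_pow] at h4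
      refine h4.trans ?_
      gcongr
      · norm_num
      · omega
    rw [Real.rpow_natCast]
    calc jb ξ ^ m * ‖𝓕 φ ξ‖ ≤ 2 ^ m * (1 + ‖ξ‖ ^ m) * ‖𝓕 φ ξ‖ := by gcongr
      _ = 2 ^ m * (‖ξ‖ ^ 0 * ‖𝓕 φ ξ‖ + ‖ξ‖ ^ m * ‖𝓕 φ ξ‖) := by ring
      _ ≤ 2 ^ m * (2 ^ 0 * (((0 : ℕ) + 1) * (B * V)) + 2 ^ m * ((m + 1) * (B * V))) := by gcongr
      _ = K * B := by rw [hK]; push_cast; ring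
  have hbound : Hn σ φ ≤ (K.toNNReal * (nrmTwo fun ξ => jbw (σ - m) ξ).toNNReal : ℝ≥0) *
      ENNReal.ofReal B := by
    calc Hn σ φ ≤ nrmTwo fun ξ => ENNReal.ofReal (K * B) * jbw (σ - m) ξ := by
          refine nrmTwo_mono fun ξ => ?_
          have e : jbw σ ξ = jbw (σ - m) ξ * jbw m ξ := by rw [← jbw_add]; simp
          rw [e, mul_assoc, mul_comm]
          gcongr
          rw [jbw, ← ofReal_norm, ← ENNReal.ofReal_mul (Real.rpow_nonneg (jb_pos ξ).le _)]
          exact ENNReal.ofReal_le_ofReal (hjb ξ)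
      _ = _ := by
          rw [nrmTwo_const_mul _ (by simp), ENNReal.ofReal_mul hK0]
          push_cast
          rw [ENNReal.coe_toNNReal hfin, ENNReal.ofReal]
          ring
  exact ⟨⟨hφi, hbound.trans_lt (ENNReal.mul_lt_top ENNReal.coe_lt_top (by simp))⟩, hbound⟩

lemma ofReal_pd_eq {φ : E3 → ℝ} (hd : Differentiable ℝ φ) (a : Fin 3) (x : E3) :
    (pd φ a x : ℂ) = fderiv ℝ (fun x => (φ x : ℂ)) x (EuclideanSpace.single a (1 : ℝ)) := by
  have h2 : HasFDerivAt (fun x => (φ x : ℂ)) (Complex.ofRealCLM.comp (fderiv ℝ φ x)) x :=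
    Complex.ofRealCLM.hasFDerivAt.comp x (hd x).hasFDerivAt
  rw [h2.fderiv, ContinuousLinearMap.comp_apply, Complex.ofRealCLM_apply, pd]

lemma integrable_fderiv_ofReal {φ : E3 → ℝ} (hd : ContDiff ℝ 1 φ) (hc : HasCompactSupport φ) :
    Integrable (fderiv ℝ fun x => (φ x : ℂ)) := by
  have hfd : ContDiff ℝ 1 fun x => (φ x : ℂ) := Complex.ofRealCLM.contDiff.comp hd
  have hfc : HasCompactSupport fun x => (φ x : ℂ) := hc.comp_left (g := ((↑) : ℝ → ℂ)) Complex.ofReal_zero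
  exact (hfd.continuous_fderiv one_ne_zero).integrable_of_hasCompactSupport (hfc.fderiv ℝ)

lemma fourier_pd {φ : E3 → ℝ} (hφ : Integrable fun x => (φ x : ℂ)) (hd : ContDiff ℝ 1 φ)
    (hc : HasCompactSupport φ) (a : Fin 3) :
    𝓕 (fun x => (pd φ a x : ℂ)) = derivHat a (𝓕 fun x => (φ x : ℂ)) := by
  have hfd : ContDiff ℝ 1 fun x => (φ x : ℂ) := Complex.ofRealCLM.contDiff.comp hd
  have hi := integrable_fderiv_ofReal hd hc
  ext ξ
  simp only [ofReal_pd_eq (hd.differentiable one_ne_zero)]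
  rw [← Real.fourier_continuousLinearMap_apply hi,
    Real.fourier_fderiv hφ (hfd.differentiable one_ne_zero) hi]
  have : innerSL ℝ ξ (EuclideanSpace.single a (1 : ℝ)) = ξ a := by
    rw [innerSL_apply_apply]
    exact (EuclideanSpace.inner_single_right a (1 : ℝ) ξ).trans (by simp)
  simp [derivHat, this]
  ring

/-- A smooth compactly supported function in `H^{s+1}` has partial derivatives in `H^s`. -/
lemma HsMem.partialDeriv {s : ℝ} {φ : E3 → ℝ} (hφ : HsMem (s + 1) fun x => (φ x : ℂ))
    (hd : ContDiff ℝ 1 φ) (hc : HasCompactSupport φ) (a : Fin 3) :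
    HsMem s (fun x => (pd φ a x : ℂ)) ∧
      Hn s (fun x => (pd φ a x : ℂ)) ≤ ENNReal.ofReal (2 * π) * Hn (s + 1) fun x => (φ x : ℂ) := by
  have hle : Hn s (fun x => (pd φ a x : ℂ)) ≤
      ENNReal.ofReal (2 * π) * Hn (s + 1) fun x => (φ x : ℂ) := by
    rw [Hn, fourier_pd hφ.1 hd hc, Hn, wNorm, wNorm, ← nrmTwo_const_mul _ ENNReal.ofReal_ne_top]
    refine nrmTwo_mono fun ξ => ?_
    refine (mul_le_mul_right (enorm_derivHat_le a _ ξ) _).trans (le_of_eq ?_)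
    rw [jbw_add]
    ring
  refine ⟨⟨?_, hle.trans_lt (ENNReal.mul_lt_top ENNReal.ofReal_lt_top hφ.2)⟩, hle⟩
  simp only [ofReal_pd_eq (hd.differentiable one_ne_zero)]
  exact (integrable_fderiv_ofReal hd hc).apply_continuousLinearMap _

namespace DyadicPartition

/-- The rescaled cut-off `x ↦ ψ_j(2^j x)`. -/
def cut (P : DyadicPartition) (j : ℕ) (x : E3) : ℝ := P.ψ j (((2:ℝ) ^ j) • x)

/-- The rescaled dyadic piece `x ↦ ψ_j(2^j x) u(2^j x)`. -/
def loc (P : DyadicPartition) (j : ℕ) (u : E3 → ℝ) (x : E3) : ℝ :=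
  P.ψ j (((2:ℝ) ^ j) • x) * u (((2:ℝ) ^ j) • x)

lemma contDiff_cut (P : DyadicPartition) (j : ℕ) : ContDiff ℝ (⊤ : ℕ∞) (P.cut j) :=
  (P.smooth j).comp (contDiff_const_smul _)

lemma norm_le_of_cut_ne_zero (P : DyadicPartition) (j : ℕ) (x : E3) (h : P.cut j x ≠ 0) :
    ‖x‖ ≤ 2 := by
  have h2 : (0:ℝ) < 2 ^ j := by positivity
  have hn : ‖((2:ℝ) ^ j) • x‖ = 2 ^ j * ‖x‖ := by
    rw [norm_smul, Real.norm_eq_abs, abs_of_pos h2]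
  rcases Nat.eq_zero_or_pos j with rfl | hj
  · simpa [hn] using P.supp_zero _ h
  · have h3 := (P.supp_succ j hj _ h).2
    rw [hn, zpow_add₀ two_ne_zero, zpow_natCast, zpow_one] at h3
    exact le_of_mul_le_mul_left h3 h2

lemma hasCompactSupport_cut (P : DyadicPartition) (j : ℕ) : HasCompactSupport (P.cut j) :=
  HasCompactSupport.intro (isCompact_closedBall (0 : E3) 2) fun x hx => by
    by_contra hne
    exact hx (by simpa using P.norm_le_of_cut_ne_zero j x hne)

lemma exists_norm_iteratedFDeriv_cut_le (P : DyadicPartition) (m : ℕ) :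
    ∃ B : ℝ, ∀ j, ∀ n ≤ m, ∀ x, ‖iteratedFDeriv ℝ n (fun x => (P.cut j x : ℂ)) x‖ ≤ B := by
  choose C hC using P.deriv_bound
  refine ⟨∑ n ∈ Finset.range (m + 1), |C n|, fun j n hn x => ?_⟩
  have h1 : ‖iteratedFDeriv ℝ n (fun x => (P.cut j x : ℂ)) x‖ = ‖iteratedFDeriv ℝ n (P.cut j) x‖ :=
    Complex.ofRealLI.norm_iteratedFDeriv_comp_left (P.contDiff_cut j).contDiffAt
      (by exact_mod_cast le_top)
  have h2 : iteratedFDeriv ℝ n (P.cut j) x =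
      ((2:ℝ) ^ j) ^ n • iteratedFDeriv ℝ n (P.ψ j) (((2:ℝ) ^ j) • x) :=
    congrFun (iteratedFDeriv_comp_const_smul ((2:ℝ) ^ j)
      ((P.smooth j).of_le (by exact_mod_cast le_top))) x
  have h3 : ((2:ℝ) ^ j) ^ n * (2:ℝ) ^ (-(n:ℤ) * (j:ℤ)) = 1 := by
    rw [← pow_mul, ← zpow_natCast, ← zpow_add₀ two_ne_zero]
    push_cast
    ring_nf
    simp
  rw [h1, h2, norm_smul, Real.norm_eq_abs, abs_of_pos (by positivity)]
  calc _ ≤ ((2:ℝ) ^ j) ^ n * (C n * (2:ℝ) ^ (-(n:ℤ) * (j:ℤ))) := by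
        gcongr
        exact hC n j _
    _ = C n := by rw [mul_comm (C n), ← mul_assoc, h3, one_mul]
    _ ≤ |C n| := le_abs_self _
    _ ≤ _ := Finset.single_le_sum (f := fun n => |C n|) (fun _ _ => abs_nonneg _)
        (Finset.mem_range.2 (by omega))

/-- The rescaled cut-offs are bounded in every `H^σ`. -/
lemma exists_Hn_cut_le (P : DyadicPartition) (σ : ℝ) :
    ∃ C : ℝ≥0, ∀ j, HsMem σ (fun x => (P.cut j x : ℂ)) ∧ Hn σ (fun x => (P.cut j x : ℂ)) ≤ C := by
  obtain ⟨m, C, hC⟩ := exists_Hn_le_of_iteratedFDeriv σ 2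
  obtain ⟨B, hB⟩ := P.exists_norm_iteratedFDeriv_cut_le m
  refine ⟨C * B.toNNReal, fun j => ?_⟩
  have := hC (fun x => (P.cut j x : ℂ)) B (Complex.ofRealCLM.contDiff.comp (P.contDiff_cut j))
    (fun x hx => P.norm_le_of_cut_ne_zero j x (by simpa using hx)) (hB j)
  simpa [ENNReal.ofReal] using this

lemma exists_Hn_pd_cut_le (P : DyadicPartition) (σ : ℝ) :
    ∃ C : ℝ≥0, ∀ j a, HsMem σ (fun x => (pd (P.cut j) a x : ℂ)) ∧
      Hn σ (fun x => (pd (P.cut j) a x : ℂ)) ≤ C := by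
  obtain ⟨C, hC⟩ := P.exists_Hn_cut_le (σ + 1)
  refine ⟨(2 * π).toNNReal * C, fun j a => ?_⟩
  have := (hC j).1.partialDeriv ((P.contDiff_cut j).of_le (by exact_mod_cast le_top))
    (P.hasCompactSupport_cut j) a
  refine ⟨this.1, this.2.trans ?_⟩
  push_cast
  rw [ENNReal.ofReal]
  gcongr
  exact (hC j).2

/-- The weight `2^{(3+2δ)j}`. -/
def wt (δ : ℝ) (j : ℕ) : ℝ := (2:ℝ) ^ ((3 + 2 * δ) * (j:ℝ))

lemma wt_pos (δ : ℝ) (j : ℕ) : 0 < wt δ j := Real.rpow_pos_of_pos two_pos _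

lemma one_le_wt {δ : ℝ} (hδ : -3 / 2 ≤ δ) (j : ℕ) : 1 ≤ wt δ j :=
  Real.one_le_rpow one_le_two (mul_nonneg (by linarith) (Nat.cast_nonneg j))

lemma HwNormSq_eq (P : DyadicPartition) (s δ : ℝ) (u : E3 → ℝ) :
    HwNormSq P s δ u =
      ∑' j, ENNReal.ofReal (wt δ j) * Hn s (fun x => (P.loc j u x : ℂ)) ^ 2 := by
  simp only [Hn_sq]
  rfl

end DyadicPartition

lemma MemH.hsMem_loc {P : DyadicPartition} {s δ : ℝ} {u : E3 → ℝ} (hu : MemH P s δ u) (j : ℕ) :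
    HsMem s (fun x => (P.loc j u x : ℂ)) := by
  constructor
  · have h1 : Integrable fun x => P.ψ j x • u x :=
      hu.1.integrable_smul_left_of_hasCompactSupport (P.smooth j).continuous (P.compSupp j)
    exact (h1.comp_smul (by positivity : (2:ℝ) ^ j ≠ 0)).ofReal
  · have h2 := hu.2
    rw [P.HwNormSq_eq] at h2
    have h3 := (ENNReal.le_tsum j).trans_lt h2
    have h4 : ENNReal.ofReal (DyadicPartition.wt δ j) ≠ 0 := by
      simpa using DyadicPartition.wt_pos δ j
    have h5 := ENNReal.lt_top_of_mul_ne_top_right h3.ne h4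
    simpa using h5

/-- The `H^s` norm of a real-valued function. -/
abbrev HnR (s : ℝ) (u : E3 → ℝ) : ℝ≥0∞ := Hn s fun x => (u x : ℂ)

/-- `u` is an integrable real-valued function with `H^s` norm at most `c`. -/
def HsBound (s : ℝ) (u : E3 → ℝ) (c : ℝ≥0∞) : Prop :=
  HsMem s (fun x => (u x : ℂ)) ∧ HnR s u ≤ c

namespace HsBound

variable {s : ℝ} {u v : E3 → ℝ} {a b : ℝ≥0∞}

lemma of_hsMem (h : HsMem s fun x => (u x : ℂ)) : HsBound s u (HnR s u) := ⟨h, le_rfl⟩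

lemma mono (h : HsBound s u a) (hab : a ≤ b) : HsBound s u b := ⟨h.1, h.2.trans hab⟩

lemma congr (h : HsBound s u a) (huv : ∀ x, u x = v x) : HsBound s v a := by
  rwa [← (funext huv : u = v)]

lemma add (hu : HsBound s u a) (hv : HsBound s v b) : HsBound s (fun x => u x + v x) (a + b) := by
  have h1 := hu.1.add hv.1
  have h2 := (Hn_add_le (s := s) hu.1.1 hv.1.1).trans (add_le_add hu.2 hv.2)
  simp only [HsBound, HnR, Complex.ofReal_add]
  exact ⟨h1, h2⟩

lemma const_mul (r : ℝ) (hu : HsBound s u a) : HsBound s (fun x => r * u x) (‖r‖ₑ * a) := by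
  simp only [HsBound, HnR, Complex.ofReal_mul]
  refine ⟨hu.1.const_mul _, ?_⟩
  rw [Hn_const_mul]
  have : ‖(r : ℂ)‖ₑ = ‖r‖ₑ := by rw [enorm_complex_ofReal, Real.enorm_eq_ofReal_abs]
  rw [this]
  gcongr
  exact hu.2

lemma neg (hu : HsBound s u a) : HsBound s (fun x => -u x) a := by
  simpa using hu.const_mul (-1)

lemma sub (hu : HsBound s u a) (hv : HsBound s v b) : HsBound s (fun x => u x - v x) (a + b) :=
  (hu.add hv.neg).congr fun _ => (sub_eq_add_neg _ _).symm

lemma sum {ι : Type*} (S : Finset ι) {w : ι → E3 → ℝ} {c : ι → ℝ≥0∞}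
    (h : ∀ i ∈ S, HsBound s (w i) (c i)) :
    HsBound s (fun x => ∑ i ∈ S, w i x) (∑ i ∈ S, c i) := by
  have := HsMem.sum S (fun i hi => (h i hi).1)
  simp only [HsBound, HnR, Complex.ofReal_sum]
  exact ⟨this.1, this.2.trans (Finset.sum_le_sum fun i hi => (h i hi).2)⟩

end HsBound

lemma exists_hsBound_mul {s : ℝ} (hs : 3 / 2 < s) : ∃ K : ℝ≥0, ∀ (u v : E3 → ℝ) (a b : ℝ≥0∞),
    HsBound s u a → HsBound s v b → HsBound s (fun x => u x * v x) (K * (a * b)) := by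
  obtain ⟨K, hK⟩ := exists_Hn_mul_le s hs
  refine ⟨K, fun u v a b hu hv => ?_⟩
  have h := hK _ _ hu.1 hv.1
  simp only [HsBound, HnR, Complex.ofReal_mul]
  refine ⟨h.1, h.2.trans ?_⟩
  rw [mul_assoc]
  gcongr
  exacts [hu.2, hv.2]

namespace DyadicPartition

/-- The product of `u(2^j x)` with a cut-off equal to one wherever `ψ_j(2^j x) ≠ 0`. -/
def til (P : DyadicPartition) (j : ℕ) (u : E3 → ℝ) (x : E3) : ℝ :=
  (1 - (1 - P.ψ (j - 1) (((2:ℝ) ^ j) • x)) * (1 - P.ψ j (((2:ℝ) ^ j) • x)) *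
    (1 - P.ψ (j + 1) (((2:ℝ) ^ j) • x))) * u (((2:ℝ) ^ j) • x)

lemma til_eq (P : DyadicPartition) (j : ℕ) (u : E3 → ℝ) (x : E3) (h : P.cut j x ≠ 0) :
    P.til j u x = u (((2:ℝ) ^ j) • x) := by
  have key : (1 - P.ψ (j - 1) (((2:ℝ) ^ j) • x)) * (1 - P.ψ j (((2:ℝ) ^ j) • x)) *
      (1 - P.ψ (j + 1) (((2:ℝ) ^ j) • x)) = 0 := by
    rw [cut] at h
    generalize ((2:ℝ) ^ j) • x = y at h ⊢
    have hup : ‖y‖ ≤ (2:ℝ) ^ ((j:ℤ) + 1) := by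
      rcases Nat.eq_zero_or_pos j with rfl | hj
      · simpa using P.supp_zero _ h
      · exact (P.supp_succ j hj _ h).2
    rcases le_or_gt ((2:ℝ) ^ (j:ℤ)) ‖y‖ with h1 | h1
    · rw [P.one_succ (j + 1) (by omega) y (by simpa using h1) (by simpa using hup)]
      simp
    rcases Nat.eq_zero_or_pos j with rfl | hj
    · rw [P.one_zero y (by simpa using h1.le)]
      simp
    rcases le_or_gt ((2:ℝ) ^ ((j:ℤ) - 1)) ‖y‖ with h2 | h2
    · rw [P.one_succ j hj y h2 h1.le]
      simp
    have hlow := (P.supp_succ j hj _ h).1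
    rcases Nat.eq_zero_or_pos (j - 1) with h3 | h3
    · have : j = 1 := by omega
      subst this
      rw [P.one_zero y (by simpa using h2.le)]
      simp
    · have h4 : ((j - 1 : ℕ) : ℤ) = (j:ℤ) - 1 := by omega
      rw [P.one_succ (j - 1) h3 y (by rw [h4]; simpa [sub_sub] using hlow)
        (by rw [h4]; exact h2.le)]
      simp
  rw [til, key, sub_zero, one_mul]

/-- The sum of the `H^s` norms of the dyadic pieces of `u` adjacent to the `j`-th one. -/
def nbNorm (P : DyadicPartition) (s : ℝ) (u : E3 → ℝ) (j : ℕ) : ℝ≥0∞ :=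
  HnR s (P.loc (j - 1) u) + HnR s (P.loc j u) + HnR s (P.loc (j + 1) u)

lemma exists_hsBound_rescale {s : ℝ} (hs : 0 ≤ s) : ∃ C : ℝ≥0, ∀ j k : ℕ,
    k = j - 1 ∨ k = j ∨ k = j + 1 → ∀ (u : E3 → ℝ) (a : ℝ≥0∞), HsBound s u a →
    HsBound s (fun x => u (((2:ℝ) ^ j / 2 ^ k) • x)) (C * a) := by
  obtain ⟨C1, h1⟩ := exists_Hn_comp_smul_le s 1 hs one_pos
  obtain ⟨C2, h2⟩ := exists_Hn_comp_smul_le s 2 hs two_pos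
  obtain ⟨C3, h3⟩ := exists_Hn_comp_smul_le s 2⁻¹ hs (by norm_num)
  refine ⟨C1 + C2 + C3, fun j k hk u a hu => ?_⟩
  have hratio : (2:ℝ) ^ j / 2 ^ k = 1 ∨ (2:ℝ) ^ j / 2 ^ k = 2 ∨ (2:ℝ) ^ j / 2 ^ k = 2⁻¹ := by
    have h0 : (2:ℝ) ^ j ≠ 0 := by positivity
    rcases hk with rfl | rfl | rfl
    · rcases j with _ | j
      · simp
      · right; left
        rw [Nat.add_sub_cancel, pow_succ]
        field_simp
    · left; field_simp
    · right; right
      rw [pow_succ]; field_simp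
  have aux : ∀ (r : ℝ) (C : ℝ≥0), C ≤ C1 + C2 + C3 →
      (∀ f : E3 → ℂ, HsMem s f → HsMem s (fun x => f (r • x)) ∧
        Hn s (fun x => f (r • x)) ≤ C * Hn s f) →
      HsBound s (fun x => u (r • x)) ((C1 + C2 + C3 : ℝ≥0) * a) := fun r C hC h => by
    refine ⟨(h _ hu.1).1, (h _ hu.1).2.trans ?_⟩
    gcongr
    exact hu.2
  rcases hratio with h | h | h <;> rw [h]
  · exact aux _ C1 (by rw [add_assoc]; exact le_self_add) h1
  · exact aux _ C2 (le_self_add.trans' le_add_self) h2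
  · exact aux _ C3 le_add_self h3

lemma exists_hsBound_til (P : DyadicPartition) {s : ℝ} (hs : 3 / 2 < s) : ∃ C : ℝ≥0,
    ∀ (j : ℕ) (u : E3 → ℝ), (∀ k, HsMem s fun x => (P.loc k u x : ℂ)) →
    HsBound s (P.til j u) (C * P.nbNorm s u j) := by
  obtain ⟨K, hK⟩ := exists_hsBound_mul hs
  obtain ⟨R, hR⟩ := exists_hsBound_rescale (s := s) (by linarith)
  obtain ⟨Q, hQ⟩ := P.exists_Hn_cut_le s
  have hsc : ∀ (j k : ℕ) (x : E3), (2:ℝ) ^ k • (((2:ℝ) ^ j / 2 ^ k) • x) = (2:ℝ) ^ j • x :=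
    fun j k x => by
      rw [smul_smul]
      congr 1
      field_simp
  refine ⟨R + K * (R * Q * R) + K * (R * Q * (R + K * (R * Q * R))), fun j u hu => ?_⟩
  have hc : ∀ k, k = j - 1 ∨ k = j ∨ k = j + 1 →
      HsBound s (fun x => P.ψ k ((2:ℝ) ^ j • x)) (R * Q) := fun k hk =>
    (hR j k hk _ _ ⟨(hQ k).1, (hQ k).2⟩).congr fun x => by simp only [cut, hsc]
  have hz : ∀ k, k = j - 1 ∨ k = j ∨ k = j + 1 →
      HsBound s (fun x => P.ψ k ((2:ℝ) ^ j • x) * u ((2:ℝ) ^ j • x)) (R * HnR s (P.loc k u)) :=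
    fun k hk => (hR j k hk _ _ (.of_hsMem (hu k))).congr fun x => by simp only [loc, hsc]
  have z1 := hz (j - 1) (by simp)
  have z2 := hz j (by simp)
  have z3 := hz (j + 1) (by simp)
  have c1 := hc (j - 1) (by simp)
  have c2 := hc j (by simp)
  have w := z3.sub (hK _ _ _ _ c2 z3)
  have t := (z1.add (z2.sub (hK _ _ _ _ c1 z2))).add (w.sub (hK _ _ _ _ c1 w))
  refine (t.congr fun x => ?_).mono ?_
  · rw [til]; ring
  · rw [nbNorm]
    generalize HnR s (P.loc (j - 1) u) = n1
    generalize HnR s (P.loc j u) = n2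
    generalize HnR s (P.loc (j + 1) u) = n3
    push_cast
    have e1 : (R * n1 + (R * n2 + K * (R * Q * (R * n2))) + (R * n3 + K * (R * Q * (R * n3)) +
        K * (R * Q * (R * n3 + K * (R * Q * (R * n3))))) : ℝ≥0∞) =
      R * n1 + (R + K * (R * Q * R)) * n2 +
        (R + K * (R * Q * R) + K * (R * Q * (R + K * (R * Q * R)))) * n3 := by ring
    rw [e1, mul_add _ (n1 + n2) n3, mul_add _ n1 n2]
    refine add_le_add_left (add_le_add (mul_le_mul_left ?_ _) (mul_le_mul_left le_self_add _)) _
    rw [add_assoc]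
    exact le_self_add

lemma ofReal_Hnorm_sq {P : DyadicPartition} {s δ : ℝ} {u : E3 → ℝ} (hu : MemH P s δ u) :
    ENNReal.ofReal (Hnorm P s δ u) ^ 2 = HwNormSq P s δ u := by
  rw [Hnorm, ← ENNReal.ofReal_pow (Real.sqrt_nonneg _), Real.sq_sqrt ENNReal.toReal_nonneg,
    ENNReal.ofReal_toReal hu.2.ne]

lemma HnR_loc_le {P : DyadicPartition} {s δ : ℝ} (hδ : -3 / 2 ≤ δ) {u : E3 → ℝ}
    (hu : MemH P s δ u) (j : ℕ) : HnR s (P.loc j u) ≤ ENNReal.ofReal (Hnorm P s δ u) := by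
  rw [← ENNReal.pow_le_pow_left_iff two_ne_zero, ofReal_Hnorm_sq hu, HwNormSq_eq]
  refine le_trans ?_ (ENNReal.le_tsum j)
  exact le_mul_of_one_le_left zero_le (by simpa using one_le_wt hδ j)

lemma exists_tsum_nbNorm_le (P : DyadicPartition) (s : ℝ) {δ : ℝ} (hδ : -3 / 2 ≤ δ) :
    ∃ C : ℝ≥0, ∀ u : E3 → ℝ,
      ∑' j, ENNReal.ofReal (wt δ j) * P.nbNorm s u j ^ 2 ≤ C * HwNormSq P s δ u := by
  set W : ℝ≥0 := (2 ^ (3 + 2 * δ) : ℝ).toNNReal with hW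
  have hsucc : ∀ j, ENNReal.ofReal (wt δ (j + 1)) = W * ENNReal.ofReal (wt δ j) := fun j => by
    rw [hW, ← ENNReal.ofReal, ← ENNReal.ofReal_mul (by positivity), wt, wt,
      ← Real.rpow_add two_pos]
    push_cast
    ring_nf
  have hmono : ∀ j, ENNReal.ofReal (wt δ j) ≤ ENNReal.ofReal (wt δ (j + 1)) := fun j => by
    refine ENNReal.ofReal_le_ofReal (Real.rpow_le_rpow_of_exponent_le one_le_two ?_)
    push_cast
    nlinarith
  refine ⟨9 * ((1 + W) + 1 + 1), fun u => ?_⟩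
  rw [HwNormSq_eq]
  set n : ℕ → ℝ≥0∞ := fun j => HnR s (P.loc j u) with hn
  set S : ℝ≥0∞ := ∑' j, ENNReal.ofReal (wt δ j) * n j ^ 2 with hS
  have hsq : ∀ a b c : ℝ≥0∞, (a + b + c) ^ 2 ≤ 9 * (a ^ 2 + b ^ 2 + c ^ 2) := fun a b c => by
    have h : a + b + c ≤ 3 * max (max a b) c := by
      have h1 : a ≤ max (max a b) c := by simp
      have h2 : b ≤ max (max a b) c := by simp
      have h3 : c ≤ max (max a b) c := by simp
      calc a + b + c ≤ _ := add_le_add (add_le_add h1 h2) h3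
        _ = _ := by ring
    refine (pow_le_pow_left' h 2).trans ?_
    rw [mul_pow]
    norm_num
    gcongr
    rcases max_choice (max a b) c with h | h <;> rw [h]
    · rcases max_choice a b with h | h <;> rw [h]
      · rw [add_assoc]; exact le_self_add
      · exact le_self_add.trans' le_add_self
    · exact le_add_self
  have h1 : ∑' j, ENNReal.ofReal (wt δ j) * n (j - 1) ^ 2 ≤ (1 + W) * S := by
    rw [tsum_eq_zero_add' ENNReal.summable, add_mul, one_mul]
    refine add_le_add (ENNReal.le_tsum 0) ?_
    simp only [hsucc, Nat.add_sub_cancel, mul_assoc]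
    rw [ENNReal.tsum_mul_left]
  have h3 : ∑' j, ENNReal.ofReal (wt δ j) * n (j + 1) ^ 2 ≤ S := by
    rw [hS, tsum_eq_zero_add' (f := fun j => ENNReal.ofReal (wt δ j) * n j ^ 2) ENNReal.summable]
    refine le_trans ?_ le_add_self
    exact ENNReal.tsum_le_tsum fun j => mul_le_mul_left (hmono j) _
  calc ∑' j, ENNReal.ofReal (wt δ j) * P.nbNorm s u j ^ 2
      ≤ ∑' j, 9 * (ENNReal.ofReal (wt δ j) * n (j - 1) ^ 2 + ENNReal.ofReal (wt δ j) * n j ^ 2 +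
          ENNReal.ofReal (wt δ j) * n (j + 1) ^ 2) := by
        refine ENNReal.tsum_le_tsum fun j => ?_
        rw [← mul_add, ← mul_add, mul_left_comm]
        gcongr
        exact hsq _ _ _
    _ = 9 * (∑' j, ENNReal.ofReal (wt δ j) * n (j - 1) ^ 2 + S +
          ∑' j, ENNReal.ofReal (wt δ j) * n (j + 1) ^ 2) := by
        rw [ENNReal.tsum_mul_left, ENNReal.tsum_add, ENNReal.tsum_add]
    _ ≤ 9 * ((1 + W) * S + S + S) := by gcongr
    _ = _ := by push_cast; ring

end DyadicPartition

lemma ENNReal.mul_le_sq_add_sq (a b : ℝ≥0∞) : a * b ≤ a ^ 2 + b ^ 2 := by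
  rw [sq, sq]
  rcases le_total a b with h | h
  · exact (mul_le_mul_left h b).trans le_add_self
  · exact (mul_le_mul_right h a).trans le_self_add

lemma ENNReal.sum_sq_le {N : ℕ} (a : Fin N → ℝ≥0∞) :
    (∑ i, a i) ^ 2 ≤ 2 * N * ∑ i, a i ^ 2 := by
  rw [sq, Finset.sum_mul_sum]
  calc ∑ i, ∑ k, a i * a k ≤ ∑ i, ∑ k, (a i ^ 2 + a k ^ 2) :=
        Finset.sum_le_sum fun i _ => Finset.sum_le_sum fun k _ => ENNReal.mul_le_sq_add_sq _ _
    _ = _ := by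
        simp only [Finset.sum_add_distrib, Finset.sum_const, Finset.card_univ, Fintype.card_fin,
          nsmul_eq_mul, ← Finset.mul_sum]
        ring

/-- The `H^s` energy estimate for a system localized by a cut-off `φ`. -/
lemma exists_cutoff_energy_le {s : ℝ} (hs : 5 / 2 < s) (N : ℕ) (κ M : ℝ≥0) :
    ∃ C : ℝ≥0, ∀ (ρ : ℝ), |ρ| ≤ 1 → ∀ (φ : E3 → ℝ), HsBound s φ κ →
      (∀ a, HsBound s (pd φ a) κ) →
      ∀ (A : Fin 3 → Fin N → Fin N → E3 → ℝ) (B : Fin N → Fin N → E3 → ℝ)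
        (u f w : Fin N → E3 → ℝ),
      (∀ a i k, A a i k = A a k i) → (∀ a i k, HsBound s (A a i k) M) →
      (∀ i k, HsBound s (B i k) M) → (∀ i, HsMem s fun x => (u i x : ℂ)) →
      (∀ i, HsMem s fun x => (f i x : ℂ)) → (∀ i, HsMem s fun x => (w i x : ℂ)) →
      (∀ i, Differentiable ℝ fun x => φ x ^ 2 * u i x) →
      (∀ i, ∀ᵐ x, w i x = φ x ^ 2 * f i x - ∑ k, φ x ^ 2 * (B i k x * u k x) -
        ρ * ∑ a, ∑ k, A a i k x *
          (pd (fun y => φ y ^ 2 * u k y) a x - 2 * (φ x * pd φ a x * u k x))) →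
      ENNReal.ofReal (∑ i, innerHs s (fun x => ((φ x ^ 2 * u i x : ℝ) : ℂ)) fun x => (w i x : ℂ)) ≤
        C * (∑ i, HnR s (u i) ^ 2 + ∑ i, HnR s (f i) ^ 2) := by
  obtain ⟨K, hK⟩ := exists_hsBound_mul (s := s) (by linarith)
  obtain ⟨C₁, hC₁⟩ := exists_sum_innerHs_le s hs
  set c : ℝ≥0 := K ^ 2 * κ ^ 2 + (K ^ 3 * κ ^ 2 * M + 3 * (2 * (K ^ 3 * κ ^ 2 * M))) with hc
  refine ⟨(N * c ^ 2 + C₁ * (N * (3 * (N * (M * c ^ 2))))) * (2 * (2 * N)), ?_⟩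
  intro ρ hρ φ hφ hpφ A B u f w hsym hA hB hu hf hw hd heq
  set X : ℝ≥0∞ := ∑ i, HnR s (u i) with hX
  set Y : ℝ≥0∞ := ∑ i, HnR s (f i) with hY
  have hXi : ∀ i, HnR s (u i) ≤ X := fun i =>
    Finset.single_le_sum (f := fun i => HnR s (u i)) (fun _ _ => zero_le) (Finset.mem_univ i)
  have hYi : ∀ i, HnR s (f i) ≤ Y := fun i =>
    Finset.single_le_sum (f := fun i => HnR s (f i)) (fun _ _ => zero_le) (Finset.mem_univ i)
  have hv : ∀ i, HsBound s (fun x => φ x ^ 2 * u i x) (c * X) := fun i => by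
    refine ((hK _ _ _ _ hφ (hK _ _ _ _ hφ (.of_hsMem (hu i)))).congr fun x => by ring).mono ?_
    calc (K * (κ * (K * (κ * HnR s (u i)))) : ℝ≥0∞) = (K ^ 2 * κ ^ 2 : ℝ≥0) * HnR s (u i) := by
          push_cast; ring
      _ ≤ _ := mul_le_mul' (ENNReal.coe_le_coe.2 le_self_add) (hXi i)
  set h : Fin N → E3 → ℝ := fun i x => φ x ^ 2 * f i x - ∑ k, φ x ^ 2 * (B i k x * u k x) +
    ∑ a, ∑ k, (2 * ρ) * (A a i k x * (φ x * (pd φ a x * u k x))) with hhdef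
  have h2ρ : ‖2 * ρ‖ₑ ≤ 2 := by
    rw [Real.enorm_eq_ofReal_abs, abs_mul, abs_two]
    refine ENNReal.ofReal_le_of_le_toReal ?_
    simp only [ENNReal.toReal_ofNat]
    linarith
  have hh : ∀ i, HsBound s (h i) (c * (X + Y)) := fun i => by
    have b1 := (hK _ _ _ _ hφ (hK _ _ _ _ hφ (.of_hsMem (hf i))))
    have b2 := HsBound.sum Finset.univ fun k _ =>
      hK _ _ _ _ hφ (hK _ _ _ _ hφ (hK _ _ _ _ (hB i k) (.of_hsMem (hu k))))
    have b3 := HsBound.sum Finset.univ fun a _ => HsBound.sum Finset.univ fun k _ =>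
      (hK _ _ _ _ (hA a i k) (hK _ _ _ _ hφ (hK _ _ _ _ (hpφ a) (.of_hsMem (hu k))))).const_mul
        (2 * ρ)
    refine (((b1.sub b2).add b3).congr fun x => ?_).mono ?_
    · simp only [hhdef]
      refine congrArg₂ (· + ·) (congrArg₂ (· - ·) (by ring) ?_) rfl
      exact Finset.sum_congr rfl fun k _ => by ring
    · have e1 : (K * (κ * (K * (κ * HnR s (f i)))) : ℝ≥0∞) ≤ (K ^ 2 * κ ^ 2 : ℝ≥0) * (X + Y) :=
        calc _ = (K ^ 2 * κ ^ 2 : ℝ≥0) * HnR s (f i) := by push_cast; ring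
          _ ≤ _ := by gcongr; exact (hYi i).trans le_add_self
      have e2 : (∑ k, K * (κ * (K * (κ * (K * (M * HnR s (u k)))))) : ℝ≥0∞) ≤
          (K ^ 3 * κ ^ 2 * M : ℝ≥0) * (X + Y) :=
        calc _ = (K ^ 3 * κ ^ 2 * M : ℝ≥0) * X := by
              rw [hX, Finset.mul_sum]
              exact Finset.sum_congr rfl fun k _ => by push_cast; ring
          _ ≤ _ := by gcongr; exact le_self_add
      have e3 : (∑ _a : Fin 3, ∑ k, ‖2 * ρ‖ₑ * (K * (M * (K * (κ * (K * (κ * HnR s (u k))))))) :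
          ℝ≥0∞) ≤ (3 * (2 * (K ^ 3 * κ ^ 2 * M)) : ℝ≥0) * (X + Y) :=
        calc _ = ∑ _a : Fin 3, ‖2 * ρ‖ₑ * ((K ^ 3 * κ ^ 2 * M : ℝ≥0) * X) := by
              refine Finset.sum_congr rfl fun a _ => ?_
              rw [hX, Finset.mul_sum, Finset.mul_sum]
              exact Finset.sum_congr rfl fun k _ => by push_cast; ring
          _ ≤ ∑ _a : Fin 3, 2 * ((K ^ 3 * κ ^ 2 * M : ℝ≥0) * (X + Y)) := by
              gcongr
              exact le_self_add
          _ = _ := by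
              simp only [Finset.sum_const, Finset.card_univ, Fintype.card_fin, nsmul_eq_mul]
              push_cast
              ring
      refine (add_le_add (add_le_add e1 e2) e3).trans (le_of_eq ?_)
      rw [hc]
      push_cast
      ring
  set g : Fin N → E3 → ℝ := fun i x => h i x - w i x with hgdef
  have hg : ∀ i, HsMem s fun x => (g i x : ℂ) := fun i => ((hh i).sub (.of_hsMem (hw i))).1
  have hρA : ∀ a i k, HsBound s (fun x => ρ * A a i k x) M := fun a i k => by
    refine ((hA a i k).const_mul ρ).mono ?_
    refine mul_le_of_le_one_left zero_le ?_
    rw [Real.enorm_eq_ofReal_abs]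
    exact ENNReal.ofReal_le_one.2 hρ
  have hadv := hC₁ N (fun a i k x => ρ * A a i k x) (fun i x => φ x ^ 2 * u i x) g
    (fun a i k => by simp only [hsym a i k]) (fun a i k => (hρA a i k).1) (fun i => (hv i).1) hd hg
    fun i => by
      filter_upwards [heq i] with x hx
      simp only [hgdef, hhdef, hx, Finset.mul_sum, mul_sub, Finset.sum_sub_distrib]
      have : ∀ a k, ρ * (A a i k x * (2 * (φ x * pd φ a x * u k x))) =
          2 * ρ * (A a i k x * (φ x * (pd φ a x * u k x))) := fun a k => by ring
      simp only [this, ← mul_assoc ρ (A _ i _ x)]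
      ring
  have hadv' : ENNReal.ofReal |∑ i, innerHs s (fun x => ((φ x ^ 2 * u i x : ℝ) : ℂ))
      fun x => (g i x : ℂ)| ≤ (C₁ * (N * (3 * (N * (M * c ^ 2)))) : ℝ≥0) * X ^ 2 := by
    refine hadv.trans ?_
    calc _ ≤ C₁ * ∑ _i : Fin N, ∑ _a : Fin 3, ∑ _k : Fin N, M * (c * X) * (c * X) := by
          gcongr with i _ a _ k _
          exacts [(hρA a i k).2, (hv i).2, (hv k).2]
      _ = _ := by
          simp only [Finset.sum_const, Finset.card_univ, Fintype.card_fin, nsmul_eq_mul]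
          push_cast
          ring
  have hlow : ENNReal.ofReal |∑ i, innerHs s (fun x => ((φ x ^ 2 * u i x : ℝ) : ℂ))
      fun x => (h i x : ℂ)| ≤ (N * c ^ 2 : ℝ≥0) * (X * (X + Y)) := by
    refine (ENNReal.ofReal_le_ofReal (Finset.abs_sum_le_sum_abs _ _)).trans ?_
    rw [ENNReal.ofReal_sum_of_nonneg fun _ _ => abs_nonneg _]
    calc _ ≤ ∑ _i : Fin N, (c * X) * (c * (X + Y)) := by
          refine Finset.sum_le_sum fun i _ => ?_
          exact (ofReal_abs_innerHs_le (hv i).1 (hh i).1).trans (mul_le_mul' (hv i).2 (hh i).2)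
      _ = _ := by
          simp only [Finset.sum_const, Finset.card_univ, Fintype.card_fin, nsmul_eq_mul]
          push_cast
          ring
  have hsplit : ∀ i, innerHs s (fun x => ((φ x ^ 2 * u i x : ℝ) : ℂ)) (fun x => (w i x : ℂ)) =
      innerHs s (fun x => ((φ x ^ 2 * u i x : ℝ) : ℂ)) (fun x => (h i x : ℂ)) -
        innerHs s (fun x => ((φ x ^ 2 * u i x : ℝ) : ℂ)) fun x => (g i x : ℂ) := fun i => by
    rw [← innerHs_sub_right (hv i).1 (hh i).1 (hg i)]
    congr 1
    ext x
    simp [hgdef]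
  simp only [hsplit, Finset.sum_sub_distrib]
  refine (ENNReal.ofReal_le_ofReal ((le_abs_self _).trans (abs_sub _ _))).trans ?_
  rw [ENNReal.ofReal_add (abs_nonneg _) (abs_nonneg _)]
  refine (add_le_add hlow hadv').trans ?_
  have hXX : X ^ 2 ≤ 2 * N * ∑ i, HnR s (u i) ^ 2 := ENNReal.sum_sq_le _
  have hYY : Y ^ 2 ≤ 2 * N * ∑ i, HnR s (f i) ^ 2 := ENNReal.sum_sq_le _
  have hXY : X * (X + Y) ≤ 2 * (X ^ 2 + Y ^ 2) := by
    rw [mul_add, two_mul, ← sq]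
    exact add_le_add le_self_add (ENNReal.mul_le_sq_add_sq _ _)
  have hX2 : X ^ 2 ≤ 2 * (X ^ 2 + Y ^ 2) := by
    rw [two_mul, add_assoc]
    exact le_self_add
  have hsum : X ^ 2 + Y ^ 2 ≤ 2 * N * (∑ i, HnR s (u i) ^ 2 + ∑ i, HnR s (f i) ^ 2) := by
    rw [mul_add]
    exact add_le_add hXX hYY
  calc _ ≤ (N * c ^ 2 : ℝ≥0) * (2 * (X ^ 2 + Y ^ 2)) +
        (C₁ * (N * (3 * (N * (M * c ^ 2)))) : ℝ≥0) * (2 * (X ^ 2 + Y ^ 2)) := by gcongr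
    _ = (N * c ^ 2 + C₁ * (N * (3 * (N * (M * c ^ 2)))) : ℝ≥0) * 2 * (X ^ 2 + Y ^ 2) := by
        push_cast
        ring
    _ ≤ (N * c ^ 2 + C₁ * (N * (3 * (N * (M * c ^ 2)))) : ℝ≥0) * 2 *
        (2 * N * (∑ i, HnR s (u i) ^ 2 + ∑ i, HnR s (f i) ^ 2)) := by gcongr
    _ = _ := by
        push_cast
        ring

lemma Real.tsum_le_toReal_tsum {f : ℕ → ℝ} {g : ℕ → ℝ≥0∞} (hfg : ∀ j, ENNReal.ofReal (f j) ≤ g j)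
    (hg : ∑' j, g j ≠ ⊤) : ∑' j, f j ≤ (∑' j, g j).toReal := by
  by_cases hf : Summable f
  · rw [ENNReal.tsum_toReal_eq fun j => ENNReal.ne_top_of_tsum_ne_top hg j]
    exact hf.tsum_le_tsum (fun j => (ENNReal.ofReal_le_iff_le_toReal
      (ENNReal.ne_top_of_tsum_ne_top hg j)).1 (hfg j)) (ENNReal.summable_toReal hg)
  · rw [tsum_eq_zero_of_not_summable hf]
    exact ENNReal.toReal_nonneg

namespace DyadicPartition

/-- The rescaled dyadic piece `x ↦ ψ_j(2^j x)² u(2^j x)`. -/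
def sqLoc (P : DyadicPartition) (j : ℕ) (u : E3 → ℝ) (x : E3) : ℝ :=
  P.ψ j (((2:ℝ) ^ j) • x) ^ 2 * u (((2:ℝ) ^ j) • x)

lemma innerHw_eq {N : ℕ} (P : DyadicPartition) (s δ : ℝ) (U V : E3 → Fin N → ℝ) :
    innerHw P s δ U V = ∑' j, wt δ j * ∑ i, innerHs s
      (fun x => (P.sqLoc j (fun y => U y i) x : ℂ)) fun x => (P.sqLoc j (fun y => V y i) x : ℂ) :=
  rfl

lemma sqLoc_eq_til (P : DyadicPartition) (j : ℕ) (u : E3 → ℝ) (x : E3) :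
    P.sqLoc j u x = P.cut j x ^ 2 * P.til j u x := by
  by_cases h : P.cut j x = 0
  · rw [sqLoc, ← cut, h]
    simp
  · rw [til_eq P j u x h, sqLoc, cut]

lemma exists_hsBound_sqLoc (P : DyadicPartition) {s : ℝ} (hs : 3 / 2 < s) : ∃ C : ℝ≥0,
    ∀ (j : ℕ) (u : E3 → ℝ), (HsMem s fun x => (P.loc j u x : ℂ)) →
    HsBound s (P.sqLoc j u) (C * HnR s (P.loc j u)) := by
  obtain ⟨K, hK⟩ := exists_hsBound_mul hs
  obtain ⟨Q, hQ⟩ := P.exists_Hn_cut_le s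
  refine ⟨K * Q, fun j u hu => ?_⟩
  refine ((hK _ _ _ _ ⟨(hQ j).1, (hQ j).2⟩ (.of_hsMem hu)).congr fun x => ?_).mono (le_of_eq ?_)
  · rw [cut, loc, sqLoc]; ring
  · push_cast; ring

lemma hasFDerivAt_sqLoc (P : DyadicPartition) (j : ℕ) {u : E3 → ℝ} (hu : Differentiable ℝ u)
    (x : E3) : HasFDerivAt (P.sqLoc j u) (P.cut j x ^ 2 • (((2:ℝ) ^ j) •
      fderiv ℝ u (((2:ℝ) ^ j) • x)) + u (((2:ℝ) ^ j) • x) •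
        ((2 * P.cut j x) • fderiv ℝ (P.cut j) x)) x := by
  have hc : HasFDerivAt (P.cut j) (fderiv ℝ (P.cut j) x) x :=
    ((P.contDiff_cut j).differentiable (by simp) x).hasFDerivAt
  have h1 := hc.pow 2
  have h2 : HasFDerivAt (fun y => u (((2:ℝ) ^ j) • y))
      (((2:ℝ) ^ j) • fderiv ℝ u (((2:ℝ) ^ j) • x)) x := by
    have h3 : HasFDerivAt (fun y : E3 => ((2:ℝ) ^ j) • y)
        (((2:ℝ) ^ j) • ContinuousLinearMap.id ℝ E3) x :=
      (((2:ℝ) ^ j) • ContinuousLinearMap.id ℝ E3).hasFDerivAt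
    refine ((hu (((2:ℝ) ^ j) • x)).hasFDerivAt.comp x h3).congr_fderiv ?_
    ext y
    simp
  refine (h1.mul h2).congr_fderiv ?_
  simp [two_mul]

lemma pd_sqLoc (P : DyadicPartition) (j : ℕ) {u : E3 → ℝ} (hu : Differentiable ℝ u) (a : Fin 3)
    (x : E3) : pd (P.sqLoc j u) a x =
      P.cut j x ^ 2 * (2 ^ j * pd u a (((2:ℝ) ^ j) • x)) +
        u (((2:ℝ) ^ j) • x) * (2 * P.cut j x * pd (P.cut j) a x) := by
  rw [pd, (P.hasFDerivAt_sqLoc j hu x).fderiv]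
  rfl

/-- The energy estimate in the weighted space at a fixed time. -/
lemma exists_innerHw_le (P : DyadicPartition) {s δ : ℝ} (hs : 5 / 2 < s) (hδ : -3 / 2 ≤ δ) (N : ℕ)
    (M : ℝ) : ∃ C : ℝ≥0, ∀ (A : Fin 3 → E3 → Fin N → Fin N → ℝ) (B : E3 → Fin N → Fin N → ℝ)
      (F U W : E3 → Fin N → ℝ),
      (∀ a i k, MemH P s δ (fun x => A a x i k) ∧ Hnorm P s δ (fun x => A a x i k) ≤ M) →
      (∀ i k, MemH P s δ (fun x => B x i k) ∧ Hnorm P s δ (fun x => B x i k) ≤ M) →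
      (∀ i, MemH P s δ fun x => F x i) → (∀ i, MemH P s δ fun x => U x i) →
      (∀ i, MemH P s δ fun x => W x i) → (∀ a x i k, A a x i k = A a x k i) →
      (∀ i, Differentiable ℝ fun x => U x i) →
      (∀ i, ∀ᵐ x, W x i + (∑ a, ∑ k, A a x i k * pd (fun y => U y k) a x) +
        (∑ k, B x i k * U x k) = F x i) →
      innerHw P s δ U W ≤ C * ((∑ i, Hnorm P s δ (fun x => U x i) ^ 2) +
        ∑ i, Hnorm P s δ (fun x => F x i) ^ 2) := by
  obtain ⟨Cn, hCn⟩ := P.exists_hsBound_til (s := s) (by linarith)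
  obtain ⟨Cq, hCq⟩ := P.exists_hsBound_sqLoc (s := s) (by linarith)
  obtain ⟨κ₁, hκ₁⟩ := P.exists_Hn_cut_le s
  obtain ⟨κ₂, hκ₂⟩ := P.exists_Hn_pd_cut_le s
  obtain ⟨Ct, hCt⟩ := P.exists_tsum_nbNorm_le s hδ
  obtain ⟨Ce, hCe⟩ := exists_cutoff_energy_le hs N (κ₁ + κ₂) (Cn * (3 * M.toNNReal))
  refine ⟨Ce * (Cn ^ 2 * Ct), fun A B F U W hA hB hF hU hW hsym hd heq => ?_⟩
  have hcoef : ∀ (b : E3 → ℝ), MemH P s δ b → Hnorm P s δ b ≤ M → ∀ j,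
      HsBound s (P.til j b) (Cn * (3 * M.toNNReal) : ℝ≥0) := fun b hb hbM j => by
    refine (hCn j b hb.hsMem_loc).mono ?_
    have h1 : ∀ k, HnR s (P.loc k b) ≤ (M.toNNReal : ℝ≥0∞) := fun k =>
      (HnR_loc_le hδ hb k).trans (ENNReal.ofReal_le_ofReal hbM)
    push_cast
    gcongr
    refine (add_le_add (add_le_add (h1 _) (h1 _)) (h1 _)).trans (le_of_eq ?_)
    ring
  have hterm : ∀ j, ENNReal.ofReal (∑ i, innerHs s
      (fun x => (P.sqLoc j (fun y => U y i) x : ℂ)) fun x => (P.sqLoc j (fun y => W y i) x : ℂ)) ≤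
      Ce * (∑ i, (Cn * P.nbNorm s (fun y => U y i) j) ^ 2 +
        ∑ i, (Cn * P.nbNorm s (fun y => F y i) j) ^ 2) := fun j => by
    have h2 : (0:ℝ) < 2 ^ j := by positivity
    have hfun : ∀ i, (fun x => P.cut j x ^ 2 * P.til j (fun y => U y i) x) =
        P.sqLoc j fun y => U y i := fun i => funext fun x => (P.sqLoc_eq_til j _ x).symm
    have key := hCe ((2:ℝ) ^ j)⁻¹ (by
        rw [abs_of_pos (inv_pos.2 h2)]
        exact inv_le_one_of_one_le₀ (one_le_pow₀ one_le_two))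
      (P.cut j) ⟨(hκ₁ j).1, (hκ₁ j).2.trans (by push_cast; exact le_self_add)⟩
      (fun a => ⟨(hκ₂ j a).1, (hκ₂ j a).2.trans (by push_cast; exact le_add_self)⟩)
      (fun a i k => P.til j fun y => A a y i k) (fun i k => P.til j fun y => B y i k)
      (fun i => P.til j fun y => U y i) (fun i => P.til j fun y => F y i)
      (fun i => P.sqLoc j fun y => W y i)
      (fun a i k => by simp only [hsym a _ i k]) (fun a i k => hcoef _ (hA a i k).1 (hA a i k).2 j)
      (fun i k => hcoef _ (hB i k).1 (hB i k).2 j) (fun i => (hCn j _ (hU i).hsMem_loc).1)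
      (fun i => (hCn j _ (hF i).hsMem_loc).1) (fun i => (hCq j _ ((hW i).hsMem_loc j)).1)
      (fun i => by
        rw [hfun i]
        exact fun x => (P.hasFDerivAt_sqLoc j (hd i) x).differentiableAt)
      (fun i => by
        filter_upwards [(Measure.quasiMeasurePreserving_smul volume h2.ne').ae (heq i)] with x hx
        simp only [hfun, P.pd_sqLoc j (hd _)]
        by_cases h0 : P.cut j x = 0
        · rw [sqLoc, ← cut, h0]
          simp
        · simp only [P.til_eq j _ x h0]
          rw [sqLoc, ← cut, eq_sub_of_add_eq (eq_sub_of_add_eq hx), ← Finset.mul_sum]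
          have : ∀ a k, A a (((2:ℝ) ^ j) • x) i k * (P.cut j x ^ 2 *
              (2 ^ j * pd (fun y => U y k) a (((2:ℝ) ^ j) • x)) +
              U (((2:ℝ) ^ j) • x) k * (2 * P.cut j x * pd (P.cut j) a x) -
              2 * (P.cut j x * pd (P.cut j) a x * U (((2:ℝ) ^ j) • x) k)) =
              (P.cut j x ^ 2 * 2 ^ j) *
                (A a (((2:ℝ) ^ j) • x) i k * pd (fun y => U y k) a (((2:ℝ) ^ j) • x)) :=
            fun a k => by ring
          simp only [this, ← Finset.mul_sum]
          field_simp)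
    simp only [← P.sqLoc_eq_til] at key
    refine key.trans ?_
    gcongr with i _ i _
    · exact (hCn j _ (hU i).hsMem_loc).2
    · exact (hCn j _ (hF i).hsMem_loc).2
  have hpiece : ∀ G : E3 → Fin N → ℝ, ∑' j, ENNReal.ofReal (wt δ j) *
      ∑ i, (Cn * P.nbNorm s (fun y => G y i) j) ^ 2 ≤
      Cn ^ 2 * Ct * ∑ i, HwNormSq P s δ fun y => G y i := fun G => by
    calc _ = ∑' j, ∑ i, Cn ^ 2 * (ENNReal.ofReal (wt δ j) * P.nbNorm s (fun y => G y i) j ^ 2) := by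
          refine tsum_congr fun j => ?_
          rw [Finset.mul_sum]
          exact Finset.sum_congr rfl fun i _ => by ring
      _ = ∑ i, Cn ^ 2 * ∑' j, ENNReal.ofReal (wt δ j) * P.nbNorm s (fun y => G y i) j ^ 2 := by
          rw [Summable.tsum_finsetSum fun _ _ => ENNReal.summable]
          exact Finset.sum_congr rfl fun i _ => ENNReal.tsum_mul_left
      _ ≤ ∑ i, Cn ^ 2 * (Ct * HwNormSq P s δ fun y => G y i) := by
          gcongr with i _
          exact hCt _
      _ = _ := by
          rw [Finset.mul_sum]
          exact Finset.sum_congr rfl fun i _ => by ring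
  have hsum : ∑' j, ENNReal.ofReal (wt δ j) *
      (Ce * (∑ i, (Cn * P.nbNorm s (fun y => U y i) j) ^ 2 +
        ∑ i, (Cn * P.nbNorm s (fun y => F y i) j) ^ 2)) ≤
      (Ce * (Cn ^ 2 * Ct) : ℝ≥0) * (∑ i, HwNormSq P s δ (fun y => U y i) +
        ∑ i, HwNormSq P s δ fun y => F y i) := by
    simp only [mul_left_comm _ (Ce : ℝ≥0∞), mul_add, ENNReal.tsum_add, ENNReal.tsum_mul_left]
    refine (add_le_add (mul_le_mul_right (hpiece U) _) (mul_le_mul_right (hpiece F) _)).trans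
      (le_of_eq ?_)
    push_cast
    ring
  have hfin : (Ce * (Cn ^ 2 * Ct) : ℝ≥0) * (∑ i, HwNormSq P s δ (fun y => U y i) +
      ∑ i, HwNormSq P s δ fun y => F y i) ≠ ⊤ :=
    ENNReal.mul_ne_top ENNReal.coe_ne_top (ENNReal.add_ne_top.2
      ⟨ENNReal.sum_ne_top.2 fun i _ => (hU i).2.ne, ENNReal.sum_ne_top.2 fun i _ => (hF i).2.ne⟩)
  rw [innerHw_eq]
  refine (Real.tsum_le_toReal_tsum (fun j => ?_) (ne_top_of_le_ne_top hfin hsum)).trans ?_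
  · rw [ENNReal.ofReal_mul (wt_pos δ j).le]
    exact mul_le_mul_right (hterm j) _
  · refine (ENNReal.toReal_mono hfin hsum).trans (le_of_eq ?_)
    have hn : ∀ u : E3 → ℝ, (HwNormSq P s δ u).toReal = Hnorm P s δ u ^ 2 := fun u => by
      rw [Hnorm, Real.sq_sqrt ENNReal.toReal_nonneg]
    rw [ENNReal.toReal_mul, ENNReal.toReal_add (ENNReal.sum_ne_top.2 fun i _ => (hU i).2.ne)
      (ENNReal.sum_ne_top.2 fun i _ => (hF i).2.ne), ENNReal.toReal_sum fun i _ => (hU i).2.ne,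
      ENNReal.toReal_sum fun i _ => (hF i).2.ne, ENNReal.coe_toReal]
    simp only [hn]

end DyadicPartition

open DyadicPartition

lemma MemH.add {P : DyadicPartition} {s δ : ℝ} {u v : E3 → ℝ} (hu : MemH P s δ u)
    (hv : MemH P s δ v) : MemH P s δ fun x => u x + v x := by
  refine ⟨hu.1.add hv.1, ?_⟩
  have h1 : ∀ a b : ℝ≥0∞, (a + b) ^ 2 ≤ 3 * (a ^ 2 + b ^ 2) := fun a b =>
    calc (a + b) ^ 2 = a ^ 2 + b ^ 2 + 2 * (a * b) := by ring
      _ ≤ a ^ 2 + b ^ 2 + 2 * (a ^ 2 + b ^ 2) := by gcongr; exact ENNReal.mul_le_sq_add_sq a b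
      _ = _ := by ring
  have h2 : HwNormSq P s δ (fun x => u x + v x) ≤ 3 * (HwNormSq P s δ u + HwNormSq P s δ v) := by
    rw [HwNormSq_eq, HwNormSq_eq, HwNormSq_eq, ← ENNReal.tsum_add, ← ENNReal.tsum_mul_left]
    refine ENNReal.tsum_le_tsum fun j => ?_
    rw [← mul_add, mul_left_comm]
    gcongr
    refine le_trans (pow_le_pow_left' ?_ 2) (h1 _ _)
    exact (((HsBound.of_hsMem (hu.hsMem_loc j)).add (.of_hsMem (hv.hsMem_loc j))).congr
      fun x => by simp only [loc]; ring).2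
  exact h2.trans_lt (ENNReal.mul_lt_top (by simp) (ENNReal.add_lt_top.2 ⟨hu.2, hv.2⟩))

lemma MemH.const_mul {P : DyadicPartition} {s δ : ℝ} {u : E3 → ℝ} (c : ℝ) (hu : MemH P s δ u) :
    MemH P s δ fun x => c * u x := by
  refine ⟨hu.1.smul c, ?_⟩
  have h2 : HwNormSq P s δ (fun x => c * u x) ≤ ‖c‖ₑ ^ 2 * HwNormSq P s δ u := by
    rw [HwNormSq_eq, HwNormSq_eq, ← ENNReal.tsum_mul_left]
    refine ENNReal.tsum_le_tsum fun j => ?_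
    rw [mul_left_comm, ← mul_pow]
    gcongr
    exact (((HsBound.of_hsMem (hu.hsMem_loc j)).const_mul c).congr
      fun x => by simp only [loc]; ring).2
  exact h2.trans_lt (ENNReal.mul_lt_top (by simp) hu.2)

lemma MemH.sub {P : DyadicPartition} {s δ : ℝ} {u v : E3 → ℝ} (hu : MemH P s δ u)
    (hv : MemH P s δ v) : MemH P s δ fun x => u x - v x := by
  simpa [sub_eq_add_neg] using hu.add (hv.const_mul (-1))

namespace DyadicPartition

lemma hasSum_Hnorm_sq {P : DyadicPartition} {s δ : ℝ} {u : E3 → ℝ} (hu : MemH P s δ u) :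
    HasSum (fun j => (√(wt δ j) * (HnR s (P.loc j u)).toReal) ^ 2) (Hnorm P s δ u ^ 2) := by
  have h2 := hu.2.ne
  rw [Hnorm, Real.sq_sqrt ENNReal.toReal_nonneg]
  rw [HwNormSq_eq] at h2 ⊢
  have h3 := ENNReal.hasSum_toReal h2
  rw [← ENNReal.tsum_toReal_eq fun j => ENNReal.ne_top_of_tsum_ne_top h2 j] at h3
  convert h3 using 2 with j
  rw [mul_pow, Real.sq_sqrt (wt_pos δ j).le, ENNReal.toReal_mul, ENNReal.toReal_pow,
    ENNReal.toReal_ofReal (wt_pos δ j).le]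

lemma Hnorm_nonneg (P : DyadicPartition) (s δ : ℝ) (u : E3 → ℝ) : 0 ≤ Hnorm P s δ u :=
  Real.sqrt_nonneg _

/-- The scalar version of the inner product of the weighted space. -/
def innerC (P : DyadicPartition) (s δ : ℝ) (u v : E3 → ℝ) : ℝ :=
  ∑' j, wt δ j * innerHs s (fun x => (P.sqLoc j u x : ℂ)) fun x => (P.sqLoc j v x : ℂ)

lemma exists_abs_innerC_le (P : DyadicPartition) {s : ℝ} (hs : 3 / 2 < s) (δ : ℝ) :
    ∃ C : ℝ, 0 ≤ C ∧ ∀ u v : E3 → ℝ, MemH P s δ u → MemH P s δ v →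
      (Summable fun j => wt δ j *
        innerHs s (fun x => (P.sqLoc j u x : ℂ)) fun x => (P.sqLoc j v x : ℂ)) ∧
      |P.innerC s δ u v| ≤ C * (Hnorm P s δ u * Hnorm P s δ v) := by
  obtain ⟨C, hC⟩ := P.exists_hsBound_sqLoc hs
  refine ⟨C ^ 2, by positivity, fun u v hu hv => ?_⟩
  have hCS := Real.summable_and_inner_le_Lp_mul_Lq_tsum_of_nonneg Real.HolderConjugate.two_two
    (f := fun j => √(wt δ j) * (HnR s (P.loc j u)).toReal)
    (g := fun j => √(wt δ j) * (HnR s (P.loc j v)).toReal)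
    (fun j => by positivity) (fun j => by positivity)
    (by simpa using (hasSum_Hnorm_sq hu).summable) (by simpa using (hasSum_Hnorm_sq hv).summable)
  have hbd : ∀ j, ‖wt δ j *
      innerHs s (fun x => (P.sqLoc j u x : ℂ)) fun x => (P.sqLoc j v x : ℂ)‖ ≤
      C ^ 2 * ((√(wt δ j) * (HnR s (P.loc j u)).toReal) *
        (√(wt δ j) * (HnR s (P.loc j v)).toReal)) := fun j => by
    have b : ∀ w, MemH P s δ w → HsMem s (fun x => (P.sqLoc j w x : ℂ)) ∧
        (HnR s (P.sqLoc j w)).toReal ≤ C * (HnR s (P.loc j w)).toReal := fun w hw => by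
      have h1 := hC j w (hw.hsMem_loc j)
      refine ⟨h1.1, ?_⟩
      have h2 := ENNReal.toReal_mono
        (ENNReal.mul_ne_top ENNReal.coe_ne_top (hw.hsMem_loc j).2.ne) h1.2
      simpa using h2
    obtain ⟨hu1, hu2⟩ := b u hu
    obtain ⟨hv1, hv2⟩ := b v hv
    rw [Real.norm_eq_abs, abs_mul, abs_of_pos (wt_pos δ j)]
    calc _ ≤ wt δ j * ((C * (HnR s (P.loc j u)).toReal) * (C * (HnR s (P.loc j v)).toReal)) := by
          refine mul_le_mul_of_nonneg_left ((abs_innerHs_le hu1 hv1).trans ?_) (wt_pos δ j).le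
          gcongr
      _ = (√(wt δ j)) ^ 2 *
          ((C * (HnR s (P.loc j u)).toReal) * (C * (HnR s (P.loc j v)).toReal)) := by
          rw [Real.sq_sqrt (wt_pos δ j).le]
      _ = _ := by ring
  have hle : ∑' j, (√(wt δ j) * (HnR s (P.loc j u)).toReal) *
      (√(wt δ j) * (HnR s (P.loc j v)).toReal) ≤ Hnorm P s δ u * Hnorm P s δ v := by
    refine hCS.2.trans (le_of_eq ?_)
    simp only [Real.rpow_two, (hasSum_Hnorm_sq hu).tsum_eq, (hasSum_Hnorm_sq hv).tsum_eq,
      ← Real.sqrt_eq_rpow]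
    rw [Real.sqrt_sq (P.Hnorm_nonneg s δ _), Real.sqrt_sq (P.Hnorm_nonneg s δ _)]
  refine ⟨.of_norm_bounded (hCS.1.mul_left _) hbd, ?_⟩
  refine (tsum_of_norm_bounded (hCS.1.mul_left _).hasSum hbd).trans ?_
  rw [tsum_mul_left]
  gcongr

lemma innerC_comm (P : DyadicPartition) (s δ : ℝ) (u v : E3 → ℝ) :
    P.innerC s δ u v = P.innerC s δ v u :=
  tsum_congr fun _ => by rw [innerHs_symm]

lemma hsMem_sqLoc {P : DyadicPartition} {s δ : ℝ} (hs : 3 / 2 < s) {u : E3 → ℝ}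
    (hu : MemH P s δ u) (j : ℕ) : HsMem s fun x => (P.sqLoc j u x : ℂ) := by
  obtain ⟨C, hC⟩ := P.exists_hsBound_sqLoc hs
  exact (hC j u (hu.hsMem_loc j)).1

lemma innerC_add_right {P : DyadicPartition} {s δ : ℝ} (hs : 3 / 2 < s) {u v w : E3 → ℝ}
    (hu : MemH P s δ u) (hv : MemH P s δ v) (hw : MemH P s δ w) :
    P.innerC s δ u (fun x => v x + w x) = P.innerC s δ u v + P.innerC s δ u w := by
  obtain ⟨C, -, hC⟩ := P.exists_abs_innerC_le hs δ
  rw [innerC, innerC, innerC, ← (hC u v hu hv).1.tsum_add (hC u w hu hw).1]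
  refine tsum_congr fun j => ?_
  rw [← mul_add, ← innerHs_add_right (hsMem_sqLoc hs hu j) (hsMem_sqLoc hs hv j)
    (hsMem_sqLoc hs hw j)]
  congr 2
  ext x
  rw [sqLoc, sqLoc, sqLoc]
  push_cast
  ring

lemma innerC_const_mul_right (P : DyadicPartition) (s δ : ℝ) (u v : E3 → ℝ) (c : ℝ) :
    P.innerC s δ u (fun x => c * v x) = c * P.innerC s δ u v := by
  rw [innerC, innerC, ← tsum_mul_left]
  refine tsum_congr fun j => ?_
  rw [mul_left_comm, ← innerHs_const_mul_right _ _ c]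
  congr 2
  ext x
  rw [sqLoc, sqLoc]
  push_cast
  ring

lemma innerC_add_self {P : DyadicPartition} {s δ : ℝ} (hs : 3 / 2 < s) {u v : E3 → ℝ}
    (hu : MemH P s δ u) (hv : MemH P s δ v) :
    P.innerC s δ (fun x => u x + v x) (fun x => u x + v x) =
      P.innerC s δ u u + 2 * P.innerC s δ u v + P.innerC s δ v v := by
  rw [innerC_add_right hs (hu.add hv) hu hv, innerC_comm _ _ _ _ u, innerC_comm _ _ _ _ v,
    innerC_add_right hs hu hu hv, innerC_add_right hs hv hu hv, innerC_comm _ _ _ v u]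
  ring

lemma innerHw_eq_sum {N : ℕ} {P : DyadicPartition} {s δ : ℝ} (hs : 3 / 2 < s)
    {U V : E3 → Fin N → ℝ} (hU : ∀ i, MemH P s δ fun x => U x i)
    (hV : ∀ i, MemH P s δ fun x => V x i) :
    innerHw P s δ U V = ∑ i, P.innerC s δ (fun x => U x i) fun x => V x i := by
  obtain ⟨C, -, hC⟩ := P.exists_abs_innerC_le hs δ
  simp only [innerHw_eq, Finset.mul_sum]
  exact Summable.tsum_finsetSum fun i _ => (hC _ _ (hU i) (hV i)).1

/-- A curve which is `C¹` with values in the weighted space has a differentiable energy. -/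
lemma hasDerivWithinAt_innerC {P : DyadicPartition} {s δ : ℝ} (hs : 3 / 2 < s) {S : Set ℝ} {t : ℝ}
    {u : ℝ → E3 → ℝ} {v : E3 → ℝ} (ht : t ∈ S) (hu : ∀ t ∈ S, MemH P s δ (u t))
    (hv : MemH P s δ v)
    (hlim : ∀ ε > (0:ℝ), ∃ η > (0:ℝ), ∀ t' ∈ S, t' ≠ t → |t' - t| < η →
      Hnorm P s δ (fun x => (u t' x - u t x) / (t' - t) - v x) < ε) :
    HasDerivWithinAt (fun τ => P.innerC s δ (u τ) (u τ)) (2 * P.innerC s δ (u t) v) S t := by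
  obtain ⟨C, hC0, hC⟩ := P.exists_abs_innerC_le hs δ
  set r : ℝ → E3 → ℝ := fun t' x => (u t' x - u t x) / (t' - t) - v x with hr
  set l := nhdsWithin t (S \ {t}) with hl
  have hrmem : ∀ t' ∈ S, MemH P s δ (r t') := fun t' ht' => by
    have := (((hu t' ht').sub (hu t ht)).const_mul (t' - t)⁻¹).sub hv
    simpa only [hr, div_eq_inv_mul] using this
  have hr0 : Filter.Tendsto (fun t' => Hnorm P s δ (r t')) l (nhds 0) := by
    rw [hl, Metric.tendsto_nhdsWithin_nhds]
    intro ε hε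
    obtain ⟨η, hη, h⟩ := hlim ε hε
    refine ⟨η, hη, fun t' ht' hd => ?_⟩
    rw [Real.dist_eq, sub_zero, abs_of_nonneg (P.Hnorm_nonneg s δ _)]
    exact h t' ht'.1 ht'.2 (by rwa [Real.dist_eq] at hd)
  have hh0 : Filter.Tendsto (fun t' => t' - t) l (nhds 0) :=
    ((continuous_sub_right t).tendsto' t 0 (sub_self t)).mono_left nhdsWithin_le_nhds
  rw [hasDerivWithinAt_iff_tendsto_slope, ← hl, tendsto_iff_norm_sub_tendsto_zero]
  have hpair : ∀ w, MemH P s δ w →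
      Filter.Tendsto (fun t' => P.innerC s δ w (r t')) l (nhds 0) := fun w hw => by
    refine squeeze_zero_norm' (a := fun t' => C * (Hnorm P s δ w * Hnorm P s δ (r t'))) ?_ ?_
    · filter_upwards [self_mem_nhdsWithin] with t' ht'
      exact (hC w _ hw (hrmem t' ht'.1)).2
    · simpa using (hr0.const_mul (Hnorm P s δ w)).const_mul C
  have hself : Filter.Tendsto (fun t' => P.innerC s δ (r t') (r t')) l (nhds 0) := by
    refine squeeze_zero_norm' (a := fun t' => C * (Hnorm P s δ (r t') * Hnorm P s δ (r t'))) ?_ ?_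
    · filter_upwards [self_mem_nhdsWithin] with t' ht'
      exact (hC _ _ (hrmem t' ht'.1) (hrmem t' ht'.1)).2
    · simpa using (hr0.mul hr0).const_mul C
  have hexp : (fun t' => slope (fun τ => P.innerC s δ (u τ) (u τ)) t t' -
      2 * P.innerC s δ (u t) v) =ᶠ[l] fun t' => 2 * P.innerC s δ (u t) (r t') + (t' - t) *
        (P.innerC s δ v v + 2 * P.innerC s δ v (r t') + P.innerC s δ (r t') (r t')) := by
    filter_upwards [self_mem_nhdsWithin] with t' ht'
    have hne : t' - t ≠ 0 := sub_ne_zero.2 ht'.2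
    have hrm := hrmem t' ht'.1
    have hut : u t' = fun x => u t x + (t' - t) * (v x + r t' x) := by
      ext x
      simp only [hr]
      field_simp
      ring
    have hq := hv.add hrm
    have e1 : P.innerC s δ (u t') (u t') = P.innerC s δ (u t) (u t) +
        2 * ((t' - t) * (P.innerC s δ (u t) v + P.innerC s δ (u t) (r t'))) +
        (t' - t) ^ 2 *
          (P.innerC s δ v v + 2 * P.innerC s δ v (r t') + P.innerC s δ (r t') (r t')) := by
      rw [hut, innerC_add_self hs (hu t ht) (hq.const_mul (t' - t)), innerC_const_mul_right,
        innerC_add_right hs (hu t ht) hv hrm, innerC_const_mul_right,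
        innerC_comm P s δ fun x => (t' - t) * (v x + r t' x),
        innerC_const_mul_right, innerC_add_self hs hv hrm]
      ring
    rw [slope_def_field, e1]
    field_simp
    ring
  have hfin : Filter.Tendsto (fun t' => 2 * P.innerC s δ (u t) (r t') + (t' - t) *
      (P.innerC s δ v v + 2 * P.innerC s δ v (r t') + P.innerC s δ (r t') (r t'))) l (nhds 0) := by
    have := ((hpair _ (hu t ht)).const_mul 2).add
      (hh0.mul ((((hpair v hv).const_mul 2).const_add (P.innerC s δ v v)).add hself))
    simpa using this
  simpa using (hfin.congr' hexp.symm).norm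

lemma exists_psi_eq_one (P : DyadicPartition) (y : E3) : ∃ j, P.ψ j y = 1 := by
  classical
  have hex : ∃ j : ℕ, ‖y‖ ≤ (2:ℝ) ^ j := by
    obtain ⟨j, hj⟩ := pow_unbounded_of_one_lt ‖y‖ one_lt_two
    exact ⟨j, hj.le⟩
  refine ⟨Nat.find hex, ?_⟩
  have hle := Nat.find_spec hex
  rcases Nat.eq_zero_or_pos (Nat.find hex) with h | h
  · rw [h] at hle ⊢
    exact P.one_zero y (by simpa using hle)
  · have hlt := Nat.find_min hex (Nat.sub_lt h one_pos)
    refine P.one_succ _ h y ?_ (by simpa using hle)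
    have h4 : ((Nat.find hex : ℕ) : ℤ) - 1 = ((Nat.find hex - 1 : ℕ) : ℤ) := by omega
    rw [h4, zpow_natCast]
    exact (not_le.1 hlt).le

/-- The derivative in the weighted space agrees a.e. with the pointwise time derivative. -/
lemma ae_eq_of_hasDerivWithinAt {P : DyadicPartition} {s δ : ℝ} (hs : 3 / 2 < s)
    (hδ : -3 / 2 ≤ δ) {S : Set ℝ} {t : ℝ} [hne : (nhdsWithin t (S \ {t})).NeBot]
    {u : ℝ → E3 → ℝ} {v : E3 → ℝ} (ht : t ∈ S) (hu : ∀ t ∈ S, MemH P s δ (u t))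
    (hv : MemH P s δ v)
    (hlim : ∀ ε > (0:ℝ), ∃ η > (0:ℝ), ∀ t' ∈ S, t' ≠ t → |t' - t| < η →
      Hnorm P s δ (fun x => (u t' x - u t x) / (t' - t) - v x) < ε) :
    ∀ᵐ x, ∀ d, HasDerivWithinAt (fun τ => u τ x) d S t → v x = d := by
  obtain ⟨C, hC⟩ := exists_ae_enorm_le s hs
  obtain ⟨τ, hτ⟩ := Filter.exists_seq_tendsto (nhdsWithin t (S \ {t}))
  have hτt : Filter.Tendsto τ Filter.atTop (nhds t) := hτ.mono_right nhdsWithin_le_nhds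
  have hτS : ∀ᶠ n in Filter.atTop, τ n ∈ S \ {t} := hτ.eventually self_mem_nhdsWithin
  set r : ℝ → E3 → ℝ := fun t' x => (u t' x - u t x) / (t' - t) - v x with hr
  have hrmem : ∀ t' ∈ S, MemH P s δ (r t') := fun t' ht' => by
    have := (((hu t' ht').sub (hu t ht)).const_mul (t' - t)⁻¹).sub hv
    simpa only [hr, div_eq_inv_mul] using this
  have hr0 : Filter.Tendsto (fun n => Hnorm P s δ (r (τ n))) Filter.atTop (nhds 0) := by
    rw [Metric.tendsto_atTop']
    intro ε hε
    obtain ⟨η, hη, h⟩ := hlim ε hε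
    have h1 := (Metric.tendsto_nhds.1 hτt η hη).and hτS
    obtain ⟨n₀, hn₀⟩ := Filter.eventually_atTop.1 h1
    refine ⟨n₀, fun n hn => ?_⟩
    obtain ⟨ha, hb⟩ := hn₀ n hn.le
    rw [Real.dist_eq, sub_zero, abs_of_nonneg (P.Hnorm_nonneg s δ _)]
    exact h (τ n) hb.1 hb.2 (by rwa [Real.dist_eq] at ha)
  have hae : ∀ᵐ y, ∀ j n, τ n ∈ S → |P.ψ j y * r (τ n) y| ≤ C * Hnorm P s δ (r (τ n)) := by
    rw [ae_all_iff]
    intro j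
    rw [ae_all_iff]
    intro n
    by_cases hn : τ n ∈ S
    · have h2 : ((2:ℝ) ^ j)⁻¹ ≠ 0 := by positivity
      have h1 := hC _ ((hrmem _ hn).hsMem_loc j)
      filter_upwards [(Measure.quasiMeasurePreserving_smul volume h2).ae h1] with y hy _
      have h3 : ((2:ℝ) ^ j) • ((2:ℝ) ^ j)⁻¹ • y = y := smul_inv_smul₀ (by positivity) y
      rw [loc, h3, enorm_complex_ofReal] at hy
      have h4 := hy.trans (mul_le_mul_right (HnR_loc_le hδ (hrmem _ hn) j) (C : ℝ≥0∞))
      rw [← ENNReal.ofReal_coe_nnreal, ← ENNReal.ofReal_mul (NNReal.coe_nonneg C)] at h4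
      exact (ENNReal.ofReal_le_ofReal_iff
        (mul_nonneg (NNReal.coe_nonneg C) (P.Hnorm_nonneg s δ _))).1 h4
    · exact .of_forall fun y h => absurd h hn
  filter_upwards [hae] with y hy d hd
  obtain ⟨j, hj⟩ := P.exists_psi_eq_one y
  have hry : Filter.Tendsto (fun n => r (τ n) y) Filter.atTop (nhds 0) := by
    refine squeeze_zero_norm' (a := fun n => C * Hnorm P s δ (r (τ n))) ?_ ?_
    · filter_upwards [hτS] with n hn
      simpa [hj] using hy j n hn.1
    · simpa using hr0.const_mul (C : ℝ)
  have hsl := (hasDerivWithinAt_iff_tendsto_slope.1 hd).comp hτ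
  have h5 : Filter.Tendsto (fun n => slope (fun τ => u τ y) t (τ n) - v y) Filter.atTop
      (nhds 0) := by
    refine hry.congr fun n => ?_
    simp only [hr, slope_def_field]
  have h6 := tendsto_nhds_unique h5 (hsl.sub_const (v y))
  linarith

end DyadicPartition

/-- Energy estimate in `H_{s,δ}` for linear symmetric hyperbolic
systems. Let `s > 5/2`, `δ ≥ -3/2`. If `A^a(t,·)` are symmetric with
`A^a(t,·), B(t,·), F(t,·) ∈ H_{s,δ}` (with norms bounded by `M`) and
`U ∈ C¹([0,T],H_{s,δ})` solves `∂ₜU + Σₐ Aᵃ∂ₐU + BU = F`, then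
`(1/2)(d/dt)⟨U(t),U(t)⟩_{s,δ} ≤ C(‖U(t)‖²_{H_{s,δ}} + ‖F(t)‖²_{H_{s,δ}})`, where `C`
depends only on `s`, `δ` and the `H_{s,δ}` norms of `A^a` and `B`. -/
theorem linear_energy_estimate (P : DyadicPartition) (s δ : ℝ)
    (hs : 5/2 < s) (hδ : -3/2 ≤ δ) (N : ℕ) (hN : 1 ≤ N) (M : ℝ) :
    ∃ C : ℝ, 0 < C ∧
      ∀ (T : ℝ), 0 < T →
      ∀ (A : Fin 3 → ℝ → E3 → Fin N → Fin N → ℝ)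
        (B : ℝ → E3 → Fin N → Fin N → ℝ) (F U : ℝ → E3 → Fin N → ℝ),
      (∀ a, ∀ t ∈ Icc (0:ℝ) T, ∀ i j, MemH P s δ (fun x => A a t x i j) ∧
        Hnorm P s δ (fun x => A a t x i j) ≤ M) →
      (∀ t ∈ Icc (0:ℝ) T, ∀ i j, MemH P s δ (fun x => B t x i j) ∧
        Hnorm P s δ (fun x => B t x i j) ≤ M) →
      (∀ t ∈ Icc (0:ℝ) T, ∀ i, MemH P s δ (fun x => F t x i)) →
      (∀ a, ∀ t ∈ Icc (0:ℝ) T, ∀ x i j, A a t x i j = A a t x j i) →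
      (∀ i, HContOn P s δ T (fun t x => U t x i)) →
      (∀ i, HC1On P s δ T (fun t x => U t x i)) →
      (∀ t ∈ Icc (0:ℝ) T, ∀ x : E3,
        (∀ i, DifferentiableAt ℝ (fun y => U t y i) x) ∧
        ∀ i : Fin N, ∃ dU : ℝ,
          HasDerivWithinAt (fun τ => U τ x i) dU (Icc (0:ℝ) T) t ∧
          dU + (∑ a : Fin 3, ∑ j : Fin N, A a t x i j * pd (fun y => U t y j) a x) +
            (∑ j : Fin N, B t x i j * U t x j) = F t x i) →
      ∃ D : ℝ → ℝ, ∀ t ∈ Icc (0:ℝ) T,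
        HasDerivWithinAt (fun τ => innerHw P s δ (U τ) (U τ)) (D t) (Icc (0:ℝ) T) t ∧
        (1/2) * D t ≤ C * ((∑ i, Hnorm P s δ (fun x => U t x i) ^ 2) +
          (∑ i, Hnorm P s δ (fun x => F t x i) ^ 2)) := by
  have hs' : 3 / 2 < s := by linarith
  obtain ⟨C, hC⟩ := P.exists_innerHw_le hs hδ N M
  refine ⟨C + 1, by positivity, fun T hT A B F U hA hB hF hsym hUc hU1 heq => ?_⟩
  choose W hWc hWlim using hU1
  have hU : ∀ t ∈ Icc (0:ℝ) T, ∀ i, MemH P s δ fun x => U t x i := fun t ht i => (hUc i).1 t ht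
  have hW : ∀ t ∈ Icc (0:ℝ) T, ∀ i, MemH P s δ fun x => W i t x := fun t ht i => (hWc i).1 t ht
  refine ⟨fun t => 2 * innerHw P s δ (U t) fun x i => W i t x, fun t ht => ⟨?_, ?_⟩⟩
  · beta_reduce
    rw [innerHw_eq_sum hs' (hU t ht) (hW t ht), Finset.mul_sum]
    have hsum := HasDerivWithinAt.fun_sum (u := Finset.univ) fun i _ =>
      hasDerivWithinAt_innerC hs' ht (hUc i).1 (hW t ht i) (hWlim i t ht)
    exact hsum.congr (fun τ hτ => innerHw_eq_sum hs' (hU τ hτ) (hU τ hτ))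
      (innerHw_eq_sum hs' (hU t ht) (hU t ht))
  · have hacc : (nhdsWithin t (Icc 0 T \ {t})).NeBot :=
      accPt_principal_iff_nhdsWithin.1 (uniqueDiffOn_Icc hT t ht).accPt
    have hmain := hC (fun a => A a t) (B t) (F t) (U t) (fun x i => W i t x)
      (fun a => hA a t ht) (hB t ht) (hF t ht) (hU t ht) (hW t ht) (fun a => hsym a t ht)
      (fun i x => (heq t ht x).1 i) fun i => by
        filter_upwards [ae_eq_of_hasDerivWithinAt hs' hδ ht (hUc i).1 (hW t ht i)
          (hWlim i t ht)] with x hx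
        obtain ⟨d, hd, h⟩ := (heq t ht x).2 i
        rw [hx d hd]
        exact h
    have hnn : 0 ≤ (∑ i, Hnorm P s δ (fun x => U t x i) ^ 2) +
      (∑ i, Hnorm P s δ (fun x => F t x i) ^ 2) := by positivity
    linarith
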